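/- arXiv:1511.07140 — 4 statements merged into one kernel-verified Lean document; each statement's English description precedes it below -/
import Mathlib

section
/- For every pair of real numbers A, B with 0 < A < B there exists a constant K = K(A,B) > 0 such that for every integer N ≥ 2 and every integer N' with N < N' ≤ 2N there exists a real number C ∈ [A,B] with |Σ_{N < n ≤ N'} d₃(n) e^{iCn^{2/3}}| ≤ K · N^{2/3} (log N)^{9/2}. -/
open Complex

/-- The ternary divisor function `d₃(n) = #{(k,ℓ,m) : k·ℓ·m = n}`. -/
def d3 (n : ℕ) : ℕ :=
  ((Finset.range (n + 1) ×ˢ Finset.range (n + 1) ×ˢ Finset.range (n + 1)).filter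
    (fun p : ℕ × ℕ × ℕ => p.1 * p.2.1 * p.2.2 = n)).card

namespace ArithmeticFunction

open scoped ArithmeticFunction.zeta Pointwise

theorem zeta_pow_mul_le (k m n : ℕ) : (ζ ^ k) (m * n) ≤ (ζ ^ k) m * (ζ ^ k) n := by
  induction k generalizing m n with
  | zero =>
    simp only [pow_zero, one_apply, mul_eq_one]
    split_ifs <;> simp_all
  | succ k ih =>
    simp only [pow_succ, mul_zeta_apply, Nat.divisors_mul]
    calc ∑ d ∈ m.divisors * n.divisors, (ζ ^ k) d
        ≤ ∑ p ∈ m.divisors ×ˢ n.divisors, (ζ ^ k) (p.1 * p.2) := by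
          rw [← Finset.image_mul_product]
          exact Finset.sum_image_le_of_nonneg (fun _ _ => Nat.zero_le _)
      _ ≤ ∑ p ∈ m.divisors ×ˢ n.divisors, (ζ ^ k) p.1 * (ζ ^ k) p.2 :=
          Finset.sum_le_sum fun _ _ => ih _ _
      _ = (∑ d ∈ m.divisors, (ζ ^ k) d) * ∑ d ∈ n.divisors, (ζ ^ k) d := by
          rw [Finset.sum_mul_sum, Finset.sum_product]

theorem zeta_pow_apply_mul_zeta_pow_apply_le (j k n : ℕ) :
    (ζ ^ j) n * (ζ ^ k) n ≤ (ζ ^ (k * j)) n := by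
  induction j generalizing n with
  | zero =>
    rcases eq_or_ne n 1 with rfl | hn
    · have h : (ζ ^ k) 1 = 1 := by
        induction k with
        | zero => simp
        | succ k ih => simp [pow_succ, ih]
      simp [h]
    · simp [hn]
  | succ j ih =>
    rw [pow_succ, mul_add, mul_one, pow_add, mul_apply, mul_apply, Finset.sum_mul]
    refine Finset.sum_le_sum fun p hp => ?_
    obtain ⟨hpn, hn⟩ := Nat.mem_divisorsAntidiagonal.mp hp
    have hp2 : p.2 ≠ 0 := by
      rintro h
      simp [h] at hpn
      exact hn hpn.symm
    rw [zeta_apply_ne hp2, mul_one, ← hpn]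
    calc (ζ ^ j) p.1 * (ζ ^ k) (p.1 * p.2)
        ≤ (ζ ^ j) p.1 * ((ζ ^ k) p.1 * (ζ ^ k) p.2) :=
          Nat.mul_le_mul_left _ (zeta_pow_mul_le k p.1 p.2)
      _ = (ζ ^ j) p.1 * (ζ ^ k) p.1 * (ζ ^ k) p.2 := (mul_assoc _ _ _).symm
      _ ≤ _ := Nat.mul_le_mul_right _ (ih p.1)

theorem sum_Ioc_zeta_pow_succ_le (k N : ℕ) :
    (∑ n ∈ Finset.Ioc 0 N, ((ζ ^ (k + 1)) n : ℝ)) ≤ N * (harmonic N : ℝ) ^ k := by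
  induction k generalizing N with
  | zero =>
    have h := sum_Ioc_zeta N
    simp only [zero_add, pow_one, pow_zero, mul_one]
    exact_mod_cast h.le
  | succ k ih =>
    have h := sum_Ioc_mul_eq_sum_sum ζ (ζ ^ (k + 1)) N
    rw [← pow_succ'] at h
    have h' : (∑ n ∈ Finset.Ioc 0 N, ((ζ ^ (k + 1 + 1)) n : ℝ)) =
        ∑ n ∈ Finset.Ioc 0 N, ∑ m ∈ Finset.Ioc 0 (N / n), ((ζ ^ (k + 1)) m : ℝ) := by
      have h2 : ∑ n ∈ Finset.Ioc 0 N, ζ n * ∑ m ∈ Finset.Ioc 0 (N / n), (ζ ^ (k + 1)) m =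
          ∑ n ∈ Finset.Ioc 0 N, ∑ m ∈ Finset.Ioc 0 (N / n), (ζ ^ (k + 1)) m :=
        Finset.sum_congr rfl fun n hn => by
          rw [zeta_apply_ne (Finset.mem_Ioc.mp hn).1.ne', one_mul]
      rw [h2] at h
      exact_mod_cast h
    have hmono : ∀ n, (harmonic (N / n) : ℝ) ≤ harmonic N := fun n => by
      have : harmonic (N / n) ≤ harmonic N := by
        unfold harmonic
        exact Finset.sum_le_sum_of_subset_of_nonneg
          (Finset.range_mono (Nat.div_le_self N n)) fun _ _ _ => by positivity
      exact_mod_cast this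
    have hnonneg : ∀ n, (0 : ℝ) ≤ harmonic n := fun n => by
      have : (0 : ℚ) ≤ harmonic n := Finset.sum_nonneg fun _ _ => by positivity
      exact_mod_cast this
    rw [h']
    calc ∑ n ∈ Finset.Ioc 0 N, ∑ m ∈ Finset.Ioc 0 (N / n), ((ζ ^ (k + 1)) m : ℝ)
        ≤ ∑ n ∈ Finset.Ioc 0 N, (N * (harmonic N : ℝ) ^ k) * (n : ℝ)⁻¹ := by
          refine Finset.sum_le_sum fun n _ => (ih (N / n)).trans ?_
          calc ((N / n : ℕ) : ℝ) * (harmonic (N / n) : ℝ) ^ k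
              ≤ (N / n : ℝ) * (harmonic N : ℝ) ^ k :=
                mul_le_mul Nat.cast_div_le (pow_le_pow_left₀ (hnonneg _) (hmono n) k)
                  (pow_nonneg (hnonneg _) k) (by positivity)
            _ = _ := by ring
      _ = N * (harmonic N : ℝ) ^ (k + 1) := by
          rw [← Finset.mul_sum, pow_succ, ← mul_assoc]
          congr 1
          rw [harmonic_eq_sum_Icc]
          push_cast
          rfl

end ArithmeticFunction

open scoped ArithmeticFunction.zeta in
theorem d3_eq_zeta_pow_three {n : ℕ} (hn : n ≠ 0) : d3 n = (ζ ^ 3) n := by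
  have h : (ζ ^ 3) n = ∑ x ∈ n.divisorsAntidiagonal, ∑ _y ∈ x.2.divisorsAntidiagonal, 1 := by
    rw [pow_succ', ArithmeticFunction.mul_apply]
    refine Finset.sum_congr rfl fun x hx => ?_
    obtain ⟨hx1, hx2⟩ := Nat.ne_zero_of_mem_divisorsAntidiagonal hx
    rw [ArithmeticFunction.zeta_apply_ne hx1, one_mul, pow_two, ArithmeticFunction.mul_apply]
    refine Finset.sum_congr rfl fun y hy => ?_
    obtain ⟨hy1, hy2⟩ := Nat.ne_zero_of_mem_divisorsAntidiagonal hy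
    simp [hy1, hy2]
  rw [h, Finset.sum_sigma', Finset.sum_const, smul_eq_mul, mul_one, d3]
  refine Finset.card_bij' (fun p _ => ⟨(p.1, p.2.1 * p.2.2), (p.2.1, p.2.2)⟩)
    (fun q _ => (q.1.1, q.2.1, q.2.2)) ?_ ?_ ?_ ?_
  · rintro ⟨a, b, c⟩ hp
    simp only [Finset.mem_filter] at hp
    obtain ⟨-, rfl⟩ := hp
    simp only [ne_eq, mul_eq_zero, not_or] at hn
    simp [mul_assoc, hn]
  · rintro ⟨⟨a, e⟩, ⟨b, c⟩⟩ hq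
    simp only [Finset.mem_sigma, Nat.mem_divisorsAntidiagonal] at hq
    obtain ⟨⟨rfl, -⟩, rfl, -⟩ := hq
    simp only [ne_eq, mul_eq_zero, not_or] at hn
    obtain ⟨ha, hb, hc⟩ := hn
    have ha := Nat.pos_of_ne_zero ha
    have hb := Nat.pos_of_ne_zero hb
    have hc := Nat.pos_of_ne_zero hc
    simp only [Finset.mem_filter, Finset.mem_product, Finset.mem_range, Nat.lt_succ_iff]
    refine ⟨⟨Nat.le_mul_of_pos_right _ (by positivity), ?_, ?_⟩, mul_assoc _ _ _⟩
    · exact (Nat.le_mul_of_pos_right _ hc).trans (Nat.le_mul_of_pos_left _ ha)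
    · exact (Nat.le_mul_of_pos_left _ hb).trans (Nat.le_mul_of_pos_left _ ha)
  · rintro ⟨a, b, c⟩ _
    rfl
  · rintro ⟨⟨a, e⟩, ⟨b, c⟩⟩ hq
    simp only [Finset.mem_sigma, Nat.mem_divisorsAntidiagonal] at hq
    obtain ⟨-, rfl, -⟩ := hq
    rfl

theorem sum_Ioc_d3_sq_le (N : ℕ) :
    ∑ n ∈ Finset.Ioc 0 N, (d3 n : ℝ) ^ 2 ≤ N * (harmonic N : ℝ) ^ 8 := by
  refine le_trans (Finset.sum_le_sum fun n hn => ?_)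
    (ArithmeticFunction.sum_Ioc_zeta_pow_succ_le 8 N)
  rw [d3_eq_zeta_pow_three (Finset.mem_Ioc.mp hn).1.ne', sq]
  exact_mod_cast ArithmeticFunction.zeta_pow_apply_mul_zeta_pow_apply_le 3 3 n

theorem norm_integral_exp_I_mul_le (A B : ℝ) {t : ℝ} (ht : t ≠ 0) :
    ‖∫ x in A..B, Complex.exp (I * t * x)‖ ≤ 2 / |t| := by
  have h : ∀ x : ℝ, ‖Complex.exp (I * t * x)‖ = 1 := fun x => by
    rw [show I * t * x = ((t * x : ℝ) : ℂ) * I by push_cast; ring]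
    exact Complex.norm_exp_ofReal_mul_I _
  rw [integral_exp_mul_complex (by simp [ht]), norm_div]
  have h2 : ‖I * (t : ℂ)‖ = |t| := by simp
  rw [h2]
  gcongr
  refine (norm_sub_le _ _).trans ?_
  rw [h, h]
  norm_num

/-- Mean-square bound for an exponential sum with real frequencies `lam`, in terms of a symmetric
majorant `w` of the correlation integrals. -/
theorem integral_norm_sum_exp_sq_le {ι : Type*} (s : Finset ι) (a lam : ι → ℝ)
    (w : ι → ι → ℝ) (A B : ℝ) (hsymm : ∀ m n, w m n = w n m)
    (hw : ∀ m ∈ s, ∀ n ∈ s,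
      ‖∫ x in A..B, Complex.exp (I * (lam m - lam n : ℝ) * x)‖ ≤ w m n) :
    ∫ x in A..B, ‖∑ n ∈ s, (a n : ℂ) * Complex.exp (I * x * lam n)‖ ^ 2 ≤
      ∑ m ∈ s, a m ^ 2 * ∑ n ∈ s, w m n := by
  have hexp : ∀ x : ℝ, ((‖∑ n ∈ s, (a n : ℂ) * Complex.exp (I * x * lam n)‖ ^ 2 : ℝ) : ℂ) =
      ∑ m ∈ s, ∑ n ∈ s, (a m * a n : ℂ) * Complex.exp (I * (lam m - lam n : ℝ) * x) := by
    intro x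
    rw [← Complex.normSq_eq_norm_sq, ← Complex.mul_conj, map_sum, Finset.sum_mul_sum]
    refine Finset.sum_congr rfl fun m _ => Finset.sum_congr rfl fun n _ => ?_
    rw [map_mul, ← Complex.exp_conj, Complex.conj_ofReal, mul_mul_mul_comm, ← Complex.exp_add]
    congr 2
    simp only [map_mul, Complex.conj_I, Complex.conj_ofReal]
    push_cast
    ring
  have hintegral : ((∫ x in A..B, ‖∑ n ∈ s, (a n : ℂ) * Complex.exp (I * x * lam n)‖ ^ 2 : ℝ) : ℂ) =
      ∑ m ∈ s, ∑ n ∈ s, (a m * a n : ℂ) *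
        ∫ x in A..B, Complex.exp (I * (lam m - lam n : ℝ) * x) := by
    rw [← intervalIntegral.integral_ofReal]
    simp_rw [hexp]
    rw [intervalIntegral.integral_finsetSum fun m _ =>
      Continuous.intervalIntegrable (by fun_prop) _ _]
    refine Finset.sum_congr rfl fun m _ => ?_
    rw [intervalIntegral.integral_finsetSum fun n _ =>
      Continuous.intervalIntegrable (by fun_prop) _ _]
    exact Finset.sum_congr rfl fun n _ => intervalIntegral.integral_const_mul _ _
  calc ∫ x in A..B, ‖∑ n ∈ s, (a n : ℂ) * Complex.exp (I * x * lam n)‖ ^ 2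
      ≤ ‖((∫ x in A..B, ‖∑ n ∈ s, (a n : ℂ) * Complex.exp (I * x * lam n)‖ ^ 2 : ℝ) : ℂ)‖ := by
        rw [Complex.norm_real]
        exact Real.le_norm_self _
    _ ≤ ∑ m ∈ s, ∑ n ∈ s, (a m ^ 2 / 2 + a n ^ 2 / 2) * w m n := by
        rw [hintegral]
        refine norm_sum_le_of_le _ fun m hm => norm_sum_le_of_le _ fun n hn => ?_
        rw [norm_mul]
        refine mul_le_mul ?_ (hw m hm n hn) (norm_nonneg _) (by positivity)
        rw [norm_mul, Complex.norm_real, Complex.norm_real, Real.norm_eq_abs, Real.norm_eq_abs]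
        nlinarith [sq_nonneg (|a m| - |a n|), sq_abs (a m), sq_abs (a n)]
    _ = (∑ m ∈ s, ∑ n ∈ s, a m ^ 2 / 2 * w m n) + ∑ m ∈ s, ∑ n ∈ s, a n ^ 2 / 2 * w m n := by
        simp_rw [add_mul, Finset.sum_add_distrib]
    _ = (∑ m ∈ s, ∑ n ∈ s, a m ^ 2 / 2 * w m n) + ∑ m ∈ s, ∑ n ∈ s, a m ^ 2 / 2 * w m n := by
        congr 1
        rw [Finset.sum_comm]
        exact Finset.sum_congr rfl fun m _ => Finset.sum_congr rfl fun n _ => by rw [hsymm]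
    _ = ∑ m ∈ s, a m ^ 2 * ∑ n ∈ s, w m n := by
        rw [← Finset.sum_add_distrib]
        refine Finset.sum_congr rfl fun m _ => ?_
        rw [← Finset.mul_sum]
        ring

theorem sub_div_le_rpow_two_thirds_sub {x y X : ℝ} (hx : 0 < x) (hxy : x ≤ y) (hy : y ≤ 2 * X) :
    (y - x) / (4 * X ^ ((1 : ℝ) / 3)) ≤ y ^ ((2 : ℝ) / 3) - x ^ ((2 : ℝ) / 3) := by
  have hX : 0 < X := by linarith
  have hy0 : 0 < y := hx.trans_le hxy
  have hsq : ∀ z : ℝ, 0 < z → z ^ ((2 : ℝ) / 3) = (z ^ ((1 : ℝ) / 3)) ^ 2 := fun z hz => by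
    rw [← Real.rpow_natCast, ← Real.rpow_mul hz.le]
    norm_num
  have hcube : ∀ z : ℝ, 0 < z → (z ^ ((1 : ℝ) / 3)) ^ 3 = z := fun z hz => by
    rw [← Real.rpow_natCast, ← Real.rpow_mul hz.le]
    norm_num
  rw [hsq x hx, hsq y hy0]
  have hxc := hcube x hx
  have hyc := hcube y hy0
  have hXc := hcube X hX
  have hu : 0 < x ^ ((1 : ℝ) / 3) := by positivity
  have hv : 0 < y ^ ((1 : ℝ) / 3) := by positivity
  have hT : 0 < X ^ ((1 : ℝ) / 3) := by positivity
  have huv : x ^ ((1 : ℝ) / 3) ≤ y ^ ((1 : ℝ) / 3) := by gcongr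
  generalize x ^ ((1 : ℝ) / 3) = u at *
  generalize y ^ ((1 : ℝ) / 3) = v at *
  generalize X ^ ((1 : ℝ) / 3) = T at *
  have hvT : v ≤ 2 * T := by
    refine le_of_pow_le_pow_left₀ three_ne_zero (by positivity) ?_
    rw [mul_pow]
    linarith
  rw [div_le_iff₀ (by positivity), ← hxc, ← hyc]
  have h1 : 0 ≤ (v - u) * (u * v) := mul_nonneg (by linarith) (by positivity)
  have h2 : 0 ≤ (v ^ 2 - u ^ 2) * (4 * T - (u + v)) :=
    mul_nonneg (by nlinarith) (by linarith)
  nlinarith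

theorem sum_Ioc_inv_abs_sub_le {N N' m : ℕ} (hN' : N' ≤ 2 * N) (hm : m ∈ Finset.Ioc N N') :
    ∑ n ∈ (Finset.Ioc N N').erase m, |(m : ℝ) - n|⁻¹ ≤ 2 * (harmonic N : ℝ) := by
  obtain ⟨hm1, hm2⟩ := Finset.mem_Ioc.mp hm
  have hH : (harmonic N : ℝ) = ∑ i ∈ Finset.Icc 1 N, (i : ℝ)⁻¹ := by
    rw [harmonic_eq_sum_Icc]
    push_cast
    rfl
  rw [← Finset.sum_filter_add_sum_filter_not _ (· < m), two_mul, hH]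
  refine add_le_add ?_ ?_
  · calc _ = ∑ i ∈ (((Finset.Ioc N N').erase m).filter (· < m)).image (m - ·), (i : ℝ)⁻¹ := by
          rw [Finset.sum_image]
          · refine Finset.sum_congr rfl fun n hn => ?_
            have h : n < m := (Finset.mem_filter.mp hn).2
            rw [Nat.cast_sub h.le, abs_of_pos (sub_pos.mpr (Nat.cast_lt.mpr h))]
          · intro p hp q hq h
            simp at hp hq h
            lia
      _ ≤ _ := by
          refine Finset.sum_le_sum_of_subset_of_nonneg ?_ fun _ _ _ => by positivity
          intro i hi
          simp at hi ⊢
          lia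
  · calc _ = ∑ i ∈ (((Finset.Ioc N N').erase m).filter (¬ · < m)).image (· - m), (i : ℝ)⁻¹ := by
          rw [Finset.sum_image]
          · refine Finset.sum_congr rfl fun n hn => ?_
            have h : m ≤ n := not_lt.mp (Finset.mem_filter.mp hn).2
            rw [Nat.cast_sub h, abs_sub_comm, abs_of_nonneg (sub_nonneg.mpr (Nat.cast_le.mpr h))]
          · intro p hp q hq h
            simp at hp hq h
            lia
      _ ≤ _ := by
          refine Finset.sum_le_sum_of_subset_of_nonneg ?_ fun _ _ _ => by positivity
          intro i hi
          simp at hi ⊢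
          lia

theorem integral_norm_sum_exp_rpow_two_thirds_sq_le {A B : ℝ} (hAB : A ≤ B) (a : ℕ → ℝ) {N N' : ℕ}
    (hN' : N' ≤ 2 * N) :
    ∫ x in A..B, ‖∑ n ∈ Finset.Ioc N N',
        (a n : ℂ) * Complex.exp (I * x * ((n : ℝ) ^ ((2 : ℝ) / 3) : ℝ))‖ ^ 2 ≤
      (B - A + 16 * (N : ℝ) ^ ((1 : ℝ) / 3) * harmonic N) * ∑ n ∈ Finset.Ioc N N', a n ^ 2 := by
  set T : ℝ := (N : ℝ) ^ ((1 : ℝ) / 3)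
  have hT0 : 0 ≤ T := by positivity
  let w : ℕ → ℕ → ℝ := fun m n => if m = n then B - A else 8 * T * |(m : ℝ) - n|⁻¹
  refine (integral_norm_sum_exp_sq_le (Finset.Ioc N N') a
    (fun n => (n : ℝ) ^ ((2 : ℝ) / 3)) w A B (fun m n => ?_) fun m hm n hn => ?_).trans ?_
  · simp only [w, eq_comm (a := m), abs_sub_comm (m : ℝ)]
  · rcases eq_or_ne m n with rfl | hmn
    · simp [w, abs_of_nonneg (sub_nonneg.mpr hAB), -Complex.ofReal_sub]
    · simp only [w, if_neg hmn]
      obtain ⟨hm1, hm2⟩ := Finset.mem_Ioc.mp hm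
      obtain ⟨hn1, hn2⟩ := Finset.mem_Ioc.mp hn
      have hNpos : 0 < N := by lia
      have hTpos : 0 < T := by positivity
      have hle : ∀ k : ℕ, k ≤ N' → (k : ℝ) ≤ 2 * N := fun k hk => by exact_mod_cast hk.trans hN'
      have hpos : ∀ k : ℕ, N < k → (0 : ℝ) < k := fun k hk => by
        exact_mod_cast (Nat.zero_le N).trans_lt hk
      have hgap : |(m : ℝ) - n| / (4 * T) ≤
          |(m : ℝ) ^ ((2 : ℝ) / 3) - (n : ℝ) ^ ((2 : ℝ) / 3)| := by
        rcases le_total m n with h | h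
        · rw [abs_sub_comm, abs_sub_comm ((m : ℝ) ^ _),
            abs_of_nonneg (sub_nonneg.mpr (Nat.cast_le.mpr h))]
          exact (sub_div_le_rpow_two_thirds_sub (hpos m hm1) (by exact_mod_cast h)
            (hle n hn2)).trans (le_abs_self _)
        · rw [abs_of_nonneg (sub_nonneg.mpr (Nat.cast_le.mpr h))]
          exact (sub_div_le_rpow_two_thirds_sub (hpos n hn1) (by exact_mod_cast h)
            (hle m hm2)).trans (le_abs_self _)
      have hd : 0 < |(m : ℝ) - n| := abs_pos.mpr (sub_ne_zero.mpr (by exact_mod_cast hmn))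
      have hd' : 0 < |(m : ℝ) - n| / (4 * T) := by positivity
      refine (norm_integral_exp_I_mul_le A B (abs_pos.mp (hd'.trans_le hgap))).trans ?_
      calc 2 / |(m : ℝ) ^ ((2 : ℝ) / 3) - (n : ℝ) ^ ((2 : ℝ) / 3)|
          ≤ 2 / (|(m : ℝ) - n| / (4 * T)) := by gcongr
        _ = 8 * T * |(m : ℝ) - n|⁻¹ := by field_simp; norm_num
  · rw [Finset.mul_sum]
    refine Finset.sum_le_sum fun m hm => ?_
    rw [mul_comm]
    refine mul_le_mul_of_nonneg_right ?_ (sq_nonneg _)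
    rw [← Finset.add_sum_erase _ _ hm]
    have h1 : w m m = B - A := if_pos rfl
    have h2 : ∑ n ∈ (Finset.Ioc N N').erase m, w m n =
        8 * T * ∑ n ∈ (Finset.Ioc N N').erase m, |(m : ℝ) - n|⁻¹ := by
      rw [Finset.mul_sum]
      exact Finset.sum_congr rfl fun n hn => if_neg (Finset.ne_of_mem_erase hn).symm
    rw [h1, h2]
    have h3 := mul_le_mul_of_nonneg_left (sum_Ioc_inv_abs_sub_le hN' hm)
      (by positivity : 0 ≤ 8 * T)
    linarith

theorem exists_mul_le_intervalIntegral {A B : ℝ} (hAB : A < B) {f : ℝ → ℝ} (hf : Continuous f) :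
    ∃ c ∈ Set.Icc A B, (B - A) * f c ≤ ∫ x in A..B, f x := by
  obtain ⟨c, hc, hmin⟩ := isCompact_Icc.exists_isMinOn (Set.nonempty_Icc.mpr hAB.le) hf.continuousOn
  refine ⟨c, hc, ?_⟩
  have h := intervalIntegral.integral_mono_on (μ := MeasureTheory.volume) hAB.le
    (intervalIntegrable_const (c := f c)) (hf.intervalIntegrable A B) fun x hx => hmin hx
  simpa using h

theorem harmonic_two_mul_le {N : ℕ} (hN : 2 ≤ N) :
    (harmonic (2 * N) : ℝ) ≤ 4 * Real.log N := by
  have h := harmonic_le_one_add_log (2 * N)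
  have h2 : Real.log 2 ≤ Real.log N := Real.log_le_log (by norm_num) (by exact_mod_cast hN)
  have h3 := Real.log_two_gt_d9
  have hN0 : (N : ℝ) ≠ 0 := by positivity
  push_cast at h
  rw [Real.log_mul two_ne_zero hN0] at h
  linarith

theorem exists_good_point (A B : ℝ) (hA : 0 < A) (hAB : A < B) :
    ∃ K : ℝ, 0 < K ∧ ∀ N : ℕ, 2 ≤ N → ∀ N' : ℕ, N < N' → N' ≤ 2 * N →
      ∃ C : ℝ, C ∈ Set.Icc A B ∧
        ‖∑ n ∈ Finset.Ioc N N',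
            (d3 n : ℂ) * Complex.exp (I * C * ((n : ℝ) ^ ((2 : ℝ) / 3) : ℝ))‖
          ≤ K * (N : ℝ) ^ ((2 : ℝ) / 3) * Real.log N ^ ((9 : ℝ) / 2) := by
  have hBA : 0 < B - A := sub_pos.mpr hAB
  set M : ℝ := 2 * 4 ^ 8 * (2 * (B - A) + 64) / (B - A) with hM
  have hM0 : 0 < M := by positivity
  refine ⟨√M, Real.sqrt_pos.mpr hM0, fun N hN N' hNN' hN' => ?_⟩
  obtain ⟨C, hC, hle⟩ := exists_mul_le_intervalIntegral hAB
    (f := fun x : ℝ => ‖∑ n ∈ Finset.Ioc N N',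
      ((d3 n : ℝ) : ℂ) * Complex.exp (I * x * ((n : ℝ) ^ ((2 : ℝ) / 3) : ℝ))‖ ^ 2) (by fun_prop)
  refine ⟨C, hC, ?_⟩
  have hmean := hle.trans
    (integral_norm_sum_exp_rpow_two_thirds_sq_le hAB.le (fun n => (d3 n : ℝ)) hN')
  simp only [Complex.ofReal_natCast] at hmean
  have hN0 : (0 : ℝ) < N := by positivity
  have hN1 : (1 : ℝ) ≤ N := by exact_mod_cast one_le_two.trans hN
  have hLlow : 1 / 2 ≤ Real.log N := by
    have h2 : Real.log 2 ≤ Real.log N := Real.log_le_log (by norm_num) (by exact_mod_cast hN)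
    linarith [Real.log_two_gt_d9]
  have hL0 : 0 < Real.log N := by linarith
  have hH2 := harmonic_two_mul_le hN
  have hHmono : (harmonic N : ℝ) ≤ harmonic (2 * N) := by
    have : harmonic N ≤ harmonic (2 * N) := Finset.sum_le_sum_of_subset_of_nonneg
      (Finset.range_mono (by lia)) fun _ _ _ => by positivity
    exact_mod_cast this
  have hH0 : (0 : ℝ) ≤ harmonic (2 * N) := by
    exact_mod_cast (harmonic_pos (by lia : 2 * N ≠ 0)).le
  have hsum : ∑ n ∈ Finset.Ioc N N', (d3 n : ℝ) ^ 2 ≤ 2 * N * (4 * Real.log N) ^ 8 := by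
    refine (Finset.sum_le_sum_of_subset_of_nonneg (Finset.Ioc_subset_Ioc (Nat.zero_le N) hN')
      fun _ _ _ => by positivity).trans ((sum_Ioc_d3_sq_le (2 * N)).trans ?_)
    push_cast
    gcongr
  have hT1 : 1 ≤ (N : ℝ) ^ ((1 : ℝ) / 3) := Real.one_le_rpow hN1 (by norm_num)
  have hTN : (N : ℝ) * (N : ℝ) ^ ((1 : ℝ) / 3) = ((N : ℝ) ^ ((2 : ℝ) / 3)) ^ 2 := by
    rw [← Real.rpow_natCast, ← Real.rpow_mul hN0.le, ← Real.rpow_one_add' hN0.le (by norm_num)]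
    norm_num
  have hLpow : (Real.log N ^ ((9 : ℝ) / 2)) ^ 2 = Real.log N ^ 9 := by
    rw [← Real.rpow_natCast, ← Real.rpow_mul hL0.le, ← Real.rpow_natCast]
    norm_num
  have hfac : B - A + 16 * (N : ℝ) ^ ((1 : ℝ) / 3) * harmonic N ≤
      (2 * (B - A) + 64) * ((N : ℝ) ^ ((1 : ℝ) / 3) * Real.log N) := by
    have h1 : 1 / 2 ≤ (N : ℝ) ^ ((1 : ℝ) / 3) * Real.log N := by nlinarith
    have h2 : (N : ℝ) ^ ((1 : ℝ) / 3) * harmonic N ≤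
        (N : ℝ) ^ ((1 : ℝ) / 3) * (4 * Real.log N) := by
      gcongr
      linarith
    nlinarith
  have hsq : ‖∑ n ∈ Finset.Ioc N N',
      (d3 n : ℂ) * Complex.exp (I * C * ((n : ℝ) ^ ((2 : ℝ) / 3) : ℝ))‖ ^ 2 ≤
      (√M * (N : ℝ) ^ ((2 : ℝ) / 3) * Real.log N ^ ((9 : ℝ) / 2)) ^ 2 := by
    refine le_of_mul_le_mul_left (hmean.trans ((mul_le_mul hfac hsum (by positivity)
      (by positivity)).trans_eq ?_)) hBA
    rw [mul_pow, mul_pow, mul_pow, Real.sq_sqrt hM0.le, hLpow, ← hTN, hM]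
    field_simp
  exact le_of_sq_le_sq hsq (by positivity)
end

section
/- For every pair of real numbers A, B with 0 < A < B there exists a constant C = C(A,B) > 0 such that for every integer N ≥ 2 and every integer N' with N < N' ≤ 2N: ∫_A^B |Σ_{N < n ≤ N'} d₃(n) e^{iαn^{2/3}}|² dα ≤ C · N^{4/3} (log N)^{9}. -/
open Complex

section

open Finset

/-- The summatory function `n ↦ ∑_{d ∣ n} f d` over divisors. -/
noncomputable def divisorSum (f : ℕ → ℝ) (n : ℕ) : ℝ := ∑ d ∈ n.divisors, f d

lemma divisorSum_nonneg {f : ℕ → ℝ} (hf : ∀ n, 0 ≤ f n) (n : ℕ) : 0 ≤ divisorSum f n :=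
  sum_nonneg fun d _ => hf d

lemma sum_Icc_sum_divisors (F : ℕ → ℕ → ℝ) (N : ℕ) :
    ∑ n ∈ Icc 1 N, ∑ d ∈ n.divisors, F d (n / d) =
      ∑ d ∈ Icc 1 N, ∑ m ∈ Icc 1 (N / d), F d m := by
  rw [sum_sigma', sum_sigma']
  refine sum_bij' (fun x _ => ⟨x.2, x.1 / x.2⟩) (fun x _ => ⟨x.1 * x.2, x.1⟩) ?_ ?_ ?_ ?_ ?_
  · rintro ⟨n, d⟩ h
    simp only [mem_sigma, mem_Icc, Nat.mem_divisors] at h ⊢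
    obtain ⟨⟨h1, h2⟩, h3, h4⟩ := h
    have hd := Nat.pos_of_dvd_of_pos h3 h1
    exact ⟨⟨hd, (Nat.le_of_dvd h1 h3).trans h2⟩, Nat.div_pos (Nat.le_of_dvd h1 h3) hd,
      Nat.div_le_div_right h2⟩
  · rintro ⟨d, m⟩ h
    simp only [mem_sigma, mem_Icc, Nat.mem_divisors] at h ⊢
    obtain ⟨⟨h1, h2⟩, h3, h4⟩ := h
    have := Nat.mul_pos h1 h3
    exact ⟨⟨this, by rw [mul_comm]; exact (Nat.le_div_iff_mul_le h1).1 h4⟩,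
      Dvd.intro _ rfl, this.ne'⟩
  · rintro ⟨n, d⟩ h
    simp only [mem_sigma, mem_Icc, Nat.mem_divisors] at h
    simp [Nat.mul_div_cancel' h.2.1]
  · rintro ⟨d, m⟩ h
    simp only [mem_sigma, mem_Icc] at h
    simp [Nat.mul_div_cancel_left m h.1.1]
  · rintro ⟨n, d⟩ h
    rfl

lemma sum_Icc_mul_divisorSum (f g : ℕ → ℝ) (N : ℕ) :
    ∑ n ∈ Icc 1 N, g n * divisorSum f n =
      ∑ d ∈ Icc 1 N, ∑ m ∈ Icc 1 (N / d), g (d * m) * f d := by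
  rw [← sum_Icc_sum_divisors fun d m => g (d * m) * f d]
  refine sum_congr rfl fun n _ => ?_
  rw [divisorSum, mul_sum]
  refine sum_congr rfl fun d hd => ?_
  rw [Nat.mul_div_cancel' (Nat.dvd_of_mem_divisors hd)]

lemma divisorSum_mul_le {f : ℕ → ℝ} (hf : ∀ n, 0 ≤ f n) (hmul : ∀ a b, f (a * b) ≤ f a * f b)
    (a b : ℕ) : divisorSum f (a * b) ≤ divisorSum f a * divisorSum f b := by
  classical
  have himage : (a * b).divisors = (a.divisors ×ˢ b.divisors).image fun p => p.1 * p.2 := by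
    rw [Nat.divisors_mul]; rfl
  calc divisorSum f (a * b)
      ≤ ∑ p ∈ a.divisors ×ˢ b.divisors, f (p.1 * p.2) := by
        rw [divisorSum, himage]
        exact sum_image_le_of_nonneg (f := f) fun p _ => hf _
    _ ≤ ∑ p ∈ a.divisors ×ˢ b.divisors, f p.1 * f p.2 := sum_le_sum fun p _ => hmul _ _
    _ = divisorSum f a * divisorSum f b := by
        rw [divisorSum, divisorSum, sum_mul_sum, sum_product]

lemma sum_div_mul_divisorSum_le {f g : ℕ → ℝ} (hf : ∀ n, 0 ≤ f n) (hg : ∀ n, 0 ≤ g n)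
    (hmul : ∀ a b, g (a * b) ≤ g a * g b) (N : ℕ) :
    ∑ n ∈ Icc 1 N, g n / n * divisorSum f n ≤
      (∑ n ∈ Icc 1 N, g n * f n / n) * ∑ n ∈ Icc 1 N, g n / n := by
  rw [sum_Icc_mul_divisorSum f (fun n => g n / n), sum_mul]
  refine sum_le_sum fun d _ => ?_
  calc ∑ m ∈ Icc 1 (N / d), g (d * m) / ((d * m : ℕ) : ℝ) * f d
      ≤ ∑ m ∈ Icc 1 (N / d), g d * f d / d * (g m / m) := by
        refine sum_le_sum fun m _ => ?_
        calc g (d * m) / ((d * m : ℕ) : ℝ) * f d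
            ≤ g d * g m / ((d * m : ℕ) : ℝ) * f d := by
              have := hmul d m
              have := hf d
              gcongr
          _ = g d * f d / d * (g m / m) := by
              push_cast
              rw [div_mul_div_comm, div_mul_eq_mul_div]
              ring_nf
    _ = g d * f d / d * ∑ m ∈ Icc 1 (N / d), g m / m := by rw [mul_sum]
    _ ≤ g d * f d / d * ∑ m ∈ Icc 1 N, g m / m := by
        refine mul_le_mul_of_nonneg_left ?_ (by have := hf d; have := hg d; positivity)
        refine sum_le_sum_of_subset_of_nonneg (Icc_subset_Icc_right (Nat.div_le_self _ _)) ?_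
        intro m _ _
        have := hg m
        positivity

lemma sum_divisorSum_le {f : ℕ → ℝ} (hf : ∀ n, 0 ≤ f n) (N : ℕ) :
    ∑ n ∈ Icc 1 N, divisorSum f n ≤ N * ∑ n ∈ Icc 1 N, f n / n := by
  have h := sum_Icc_mul_divisorSum f (fun _ => 1) N
  simp only [one_mul, sum_const, Nat.card_Icc, Nat.add_sub_cancel, nsmul_eq_mul] at h
  rw [h, mul_sum]
  refine sum_le_sum fun d _ => ?_
  calc ((N / d : ℕ) : ℝ) * f d ≤ N / d * f d :=
        mul_le_mul_of_nonneg_right Nat.cast_div_le (hf d)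
    _ = N * (f d / d) := by ring

/-- The real-valued divisor function. -/
noncomputable def tau2 : ℕ → ℝ := divisorSum fun _ => 1

/-- The real-valued ternary divisor function, as an iterated divisor sum. -/
noncomputable def tau3 : ℕ → ℝ := divisorSum tau2

lemma tau2_nonneg (n : ℕ) : 0 ≤ tau2 n := divisorSum_nonneg (fun _ => zero_le_one) n

lemma tau3_nonneg (n : ℕ) : 0 ≤ tau3 n := divisorSum_nonneg tau2_nonneg n

lemma tau3_mul_le (a b : ℕ) : tau3 (a * b) ≤ tau3 a * tau3 b :=
  divisorSum_mul_le tau2_nonneg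
    (divisorSum_mul_le (fun _ => zero_le_one) fun _ _ => by simp) a b

lemma sum_divisorSum_div_le {f : ℕ → ℝ} (hf : ∀ n, 0 ≤ f n) (N : ℕ) :
    ∑ n ∈ Icc 1 N, divisorSum f n / n ≤
      (∑ n ∈ Icc 1 N, f n / n) * ∑ n ∈ Icc 1 N, 1 / (n : ℝ) := by
  have h := sum_div_mul_divisorSum_le hf (g := fun _ => 1) (fun _ => zero_le_one)
    (fun _ _ => by simp) N
  simpa only [one_mul, div_mul_eq_mul_div] using h

lemma sum_tau2_div_le (N : ℕ) :
    ∑ n ∈ Icc 1 N, tau2 n / n ≤ (∑ n ∈ Icc 1 N, 1 / (n : ℝ)) ^ 2 :=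
  (sum_divisorSum_div_le (fun _ => zero_le_one) N).trans_eq (sq _).symm

lemma sum_tau3_div_le (N : ℕ) :
    ∑ n ∈ Icc 1 N, tau3 n / n ≤ (∑ n ∈ Icc 1 N, 1 / (n : ℝ)) ^ 3 := by
  refine (sum_divisorSum_div_le tau2_nonneg N).trans ?_
  rw [pow_succ]
  exact mul_le_mul_of_nonneg_right (sum_tau2_div_le N) (by positivity)

lemma sum_tau3_le (N : ℕ) :
    ∑ n ∈ Icc 1 N, tau3 n ≤ N * (∑ n ∈ Icc 1 N, 1 / (n : ℝ)) ^ 2 :=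
  (sum_divisorSum_le tau2_nonneg N).trans
    (mul_le_mul_of_nonneg_left (sum_tau2_div_le N) (Nat.cast_nonneg N))

lemma sum_tau3_mul_tau2_div_le (N : ℕ) :
    ∑ n ∈ Icc 1 N, tau3 n * tau2 n / n ≤ (∑ n ∈ Icc 1 N, 1 / (n : ℝ)) ^ 6 := by
  have h := sum_div_mul_divisorSum_le (f := fun _ => 1) (fun _ => zero_le_one) tau3_nonneg
    tau3_mul_le N
  have h0 : 0 ≤ ∑ n ∈ Icc 1 N, tau3 n / n :=
    sum_nonneg fun n _ => div_nonneg (tau3_nonneg n) (Nat.cast_nonneg n)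
  calc ∑ n ∈ Icc 1 N, tau3 n * tau2 n / n
      = ∑ n ∈ Icc 1 N, tau3 n / n * divisorSum (fun _ => 1) n :=
        sum_congr rfl fun n _ => by rw [div_mul_eq_mul_div]; rfl
    _ ≤ (∑ n ∈ Icc 1 N, tau3 n / n) ^ 2 := by simpa only [mul_one, sq] using h
    _ ≤ ((∑ n ∈ Icc 1 N, 1 / (n : ℝ)) ^ 3) ^ 2 := pow_le_pow_left₀ h0 (sum_tau3_div_le N) 2
    _ = (∑ n ∈ Icc 1 N, 1 / (n : ℝ)) ^ 6 := by rw [← pow_mul]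

lemma sum_tau3_sq_le (N : ℕ) :
    ∑ n ∈ Icc 1 N, tau3 n ^ 2 ≤ N * (∑ n ∈ Icc 1 N, 1 / (n : ℝ)) ^ 8 := by
  set H := ∑ n ∈ Icc 1 N, 1 / (n : ℝ) with hH
  calc ∑ n ∈ Icc 1 N, tau3 n ^ 2 = ∑ n ∈ Icc 1 N, tau3 n * divisorSum tau2 n :=
        sum_congr rfl fun n _ => sq _
    _ = ∑ d ∈ Icc 1 N, ∑ m ∈ Icc 1 (N / d), tau3 (d * m) * tau2 d :=
        sum_Icc_mul_divisorSum _ _ _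
    _ ≤ ∑ d ∈ Icc 1 N, N * H ^ 2 * (tau3 d * tau2 d / d) := by
        refine sum_le_sum fun d _ => ?_
        have hdd : 0 ≤ tau3 d * tau2 d := mul_nonneg (tau3_nonneg d) (tau2_nonneg d)
        calc ∑ m ∈ Icc 1 (N / d), tau3 (d * m) * tau2 d
            ≤ ∑ m ∈ Icc 1 (N / d), tau3 d * tau2 d * tau3 m := by
              refine sum_le_sum fun m _ => ?_
              rw [mul_right_comm]
              exact mul_le_mul_of_nonneg_right (tau3_mul_le d m) (tau2_nonneg d)
          _ = tau3 d * tau2 d * ∑ m ∈ Icc 1 (N / d), tau3 m := by rw [mul_sum]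
          _ ≤ tau3 d * tau2 d * (N / d * H ^ 2) := by
              refine mul_le_mul_of_nonneg_left ((sum_tau3_le _).trans ?_) hdd
              have : ∑ n ∈ Icc 1 (N / d), 1 / (n : ℝ) ≤ H :=
                sum_le_sum_of_subset_of_nonneg (Icc_subset_Icc_right (Nat.div_le_self _ _))
                  fun m _ _ => by positivity
              have hcast : ((N / d : ℕ) : ℝ) ≤ N / d := Nat.cast_div_le
              gcongr
          _ = N * H ^ 2 * (tau3 d * tau2 d / d) := by ring
    _ = N * H ^ 2 * ∑ d ∈ Icc 1 N, tau3 d * tau2 d / d := by rw [mul_sum]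
    _ ≤ N * H ^ 2 * H ^ 6 :=
        mul_le_mul_of_nonneg_left (sum_tau3_mul_tau2_div_le N) (by positivity)
    _ = N * H ^ 8 := by ring

lemma d3_le_tau3 {n : ℕ} (hn : n ≠ 0) : (d3 n : ℝ) ≤ tau3 n := by
  have hcard : tau3 n = (n.divisors.sigma fun d => d.divisors).card := by
    rw [card_sigma]
    simp [tau3, tau2, divisorSum]
  rw [hcard, d3]
  refine Nat.cast_le.2 (card_le_card_of_injOn (fun p => ⟨p.1 * p.2.1, p.1⟩) ?_ ?_)
  · rintro ⟨k, l, m⟩ h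
    simp only [coe_filter, Set.mem_ofPred_eq] at h
    obtain ⟨-, h⟩ := h
    have hkl : k * l ≠ 0 := by
      rintro h0
      simp [h0] at h
      exact hn h.symm
    simp only [coe_sigma, Set.mem_sigma_iff, mem_coe, Nat.mem_divisors]
    exact ⟨⟨⟨m, h.symm⟩, hn⟩, ⟨l, rfl⟩, hkl⟩
  · rintro ⟨k, l, m⟩ h ⟨k₂, l₂, m₂⟩ h₂ heq
    simp only [coe_filter, Set.mem_ofPred_eq] at h h₂
    obtain ⟨-, h⟩ := h
    obtain ⟨-, h₂⟩ := h₂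
    simp only [Sigma.mk.injEq, heq_eq_eq] at heq
    obtain ⟨h1, rfl⟩ := heq
    have hkl : k * l ≠ 0 := by
      rintro h0
      simp [h0] at h
      exact hn h.symm
    have hl : l = l₂ := mul_left_cancel₀ (left_ne_zero_of_mul hkl) h1
    subst hl
    have hm : m = m₂ := mul_left_cancel₀ hkl (h.trans h₂.symm)
    rw [hm]

lemma norm_sum_mul_exp_sq (s : Finset ℕ) (a θ : ℕ → ℝ) :
    ‖∑ n ∈ s, (a n : ℂ) * exp (I * θ n)‖ ^ 2 =
      ∑ n ∈ s, ∑ m ∈ s, a n * a m * Real.cos (θ n - θ m) := by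
  have hexp (n : ℕ) : (a n : ℂ) * exp (I * θ n) =
      (a n * Real.cos (θ n) : ℝ) + (a n * Real.sin (θ n) : ℝ) * I := by
    rw [mul_comm I, exp_mul_I]
    push_cast
    ring
  simp_rw [hexp, sum_add_distrib, ← sum_mul, ← ofReal_sum]
  rw [← normSq_eq_norm_sq, normSq_add_mul_I, sq, sq, sum_mul_sum, sum_mul_sum,
    ← sum_add_distrib]
  refine sum_congr rfl fun n _ => ?_
  rw [← sum_add_distrib]
  refine sum_congr rfl fun m _ => ?_
  rw [Real.cos_sub]
  ring

lemma integral_cos_mul_le_sub {A B : ℝ} (hAB : A ≤ B) (μ : ℝ) :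
    ∫ α in A..B, Real.cos (α * μ) ≤ B - A := by
  have h := intervalIntegral.integral_mono_on (f := fun α => Real.cos (α * μ)) (g := fun _ => 1)
    (μ := MeasureTheory.volume) hAB (by apply Continuous.intervalIntegrable; fun_prop)
    (by apply Continuous.intervalIntegrable; fun_prop) fun α _ => Real.cos_le_one _
  simpa using h

lemma integral_cos_mul_le_div {A B μ : ℝ} (hμ : μ ≠ 0) :
    ∫ α in A..B, Real.cos (α * μ) ≤ 2 / |μ| := by
  rw [intervalIntegral.integral_comp_mul_right (fun x => Real.cos x) hμ, integral_cos, smul_eq_mul]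
  calc μ⁻¹ * (Real.sin (B * μ) - Real.sin (A * μ))
      ≤ |μ⁻¹ * (Real.sin (B * μ) - Real.sin (A * μ))| := le_abs_self _
    _ = |μ|⁻¹ * |Real.sin (B * μ) - Real.sin (A * μ)| := by rw [abs_mul, abs_inv]
    _ ≤ |μ|⁻¹ * 2 := by
        refine mul_le_mul_of_nonneg_left ?_ (by positivity)
        rw [abs_le]
        constructor <;>
          linarith [Real.sin_le_one (B * μ), Real.neg_one_le_sin (B * μ),
            Real.sin_le_one (A * μ), Real.neg_one_le_sin (A * μ)]
    _ = 2 / |μ| := by rw [div_eq_inv_mul]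

lemma sub_le_mul_rpow_two_thirds_sub {x y X : ℝ} (hx : 0 ≤ x) (hxy : x < y) (hyX : y ≤ X) :
    y - x ≤ 2 * X ^ ((1 : ℝ) / 3) * (y ^ ((2 : ℝ) / 3) - x ^ ((2 : ℝ) / 3)) := by
  have hy : 0 ≤ y := hx.trans hxy.le
  have hsq {t : ℝ} (ht : 0 ≤ t) : t ^ ((2 : ℝ) / 3) = (t ^ ((1 : ℝ) / 3)) ^ 2 := by
    rw [← Real.rpow_natCast, ← Real.rpow_mul ht]
    norm_num
  have hcube {t : ℝ} (ht : 0 ≤ t) : t = (t ^ ((1 : ℝ) / 3)) ^ 3 := by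
    rw [← Real.rpow_natCast, ← Real.rpow_mul ht]
    norm_num
  have huv : x ^ ((1 : ℝ) / 3) ≤ y ^ ((1 : ℝ) / 3) := by gcongr
  have hvw : y ^ ((1 : ℝ) / 3) ≤ X ^ ((1 : ℝ) / 3) := by gcongr
  have hu : 0 ≤ x ^ ((1 : ℝ) / 3) := by positivity
  rw [hsq hx, hsq hy]
  conv_lhs => rw [hcube hx, hcube hy]
  generalize x ^ ((1 : ℝ) / 3) = u at *
  generalize y ^ ((1 : ℝ) / 3) = v at *
  generalize X ^ ((1 : ℝ) / 3) = w at *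
  have hv : 0 ≤ v := hu.trans huv
  calc v ^ 3 - u ^ 3 = (v - u) * (v ^ 2 + v * u + u ^ 2) := by ring
    _ ≤ (v - u) * (2 * w * (v + u)) := by
        refine mul_le_mul_of_nonneg_left ?_ (by linarith)
        nlinarith [mul_nonneg hu hv, mul_nonneg (sub_nonneg.2 hvw) hv,
          mul_nonneg (sub_nonneg.2 (huv.trans hvw)) hu]
    _ = 2 * w * (v ^ 2 - u ^ 2) := by ring

lemma abs_sub_le_mul_abs_rpow_two_thirds_sub {x y X : ℝ} (hx : 0 ≤ x) (hy : 0 ≤ y)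
    (hxX : x ≤ X) (hyX : y ≤ X) :
    |x - y| ≤ 2 * X ^ ((1 : ℝ) / 3) * |x ^ ((2 : ℝ) / 3) - y ^ ((2 : ℝ) / 3)| := by
  have key {x y : ℝ} (hx : 0 ≤ x) (hxy : x < y) (hyX : y ≤ X) :
      |x - y| ≤ 2 * X ^ ((1 : ℝ) / 3) * |x ^ ((2 : ℝ) / 3) - y ^ ((2 : ℝ) / 3)| := by
    rw [abs_sub_comm, abs_of_pos (sub_pos.2 hxy), abs_sub_comm]
    have hX : 0 ≤ X := hx.trans (hxy.le.trans hyX)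
    exact (sub_le_mul_rpow_two_thirds_sub hx hxy hyX).trans
      (mul_le_mul_of_nonneg_left (le_abs_self _) (by positivity))
  rcases lt_trichotomy x y with h | rfl | h
  · exact key hx h hyX
  · simp
  · rw [abs_sub_comm, abs_sub_comm (x ^ ((2 : ℝ) / 3))]
    exact key hy h hxX

lemma integral_cos_rpow_two_thirds_le {A B x y X : ℝ} (hx : 0 ≤ x) (hy : 0 ≤ y)
    (hxX : x ≤ X) (hyX : y ≤ X) (hxy : x ≠ y) :
    ∫ α in A..B, Real.cos (α * (x ^ ((2 : ℝ) / 3) - y ^ ((2 : ℝ) / 3))) ≤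
      4 * X ^ ((1 : ℝ) / 3) * (1 / |x - y|) := by
  have hpos : 0 < |x - y| := abs_pos.2 (sub_ne_zero.2 hxy)
  have h := abs_sub_le_mul_abs_rpow_two_thirds_sub hx hy hxX hyX
  have hμ : x ^ ((2 : ℝ) / 3) - y ^ ((2 : ℝ) / 3) ≠ 0 := by
    intro h0
    rw [h0, abs_zero, mul_zero] at h
    linarith
  refine (integral_cos_mul_le_div hμ).trans ?_
  rw [mul_one_div, div_le_div_iff₀ (abs_pos.2 hμ) hpos]
  linarith

/-- A Schur-test bound for a quadratic form with symmetric nonnegative kernel. -/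
lemma sum_sum_mul_mul_le {s : Finset ℕ} {a : ℕ → ℝ} {c : ℕ → ℕ → ℝ} {M : ℝ}
    (hc : ∀ n m, 0 ≤ c n m) (hsymm : ∀ n m, c n m = c m n)
    (hM : ∀ n ∈ s, ∑ m ∈ s, c n m ≤ M) :
    ∑ n ∈ s, ∑ m ∈ s, a n * a m * c n m ≤ M * ∑ n ∈ s, a n ^ 2 := by
  have hswap : ∑ n ∈ s, ∑ m ∈ s, a m ^ 2 * c n m = ∑ n ∈ s, ∑ m ∈ s, a n ^ 2 * c n m := by
    rw [sum_comm]
    exact sum_congr rfl fun n _ => sum_congr rfl fun m _ => by rw [hsymm]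
  calc ∑ n ∈ s, ∑ m ∈ s, a n * a m * c n m
      ≤ ∑ n ∈ s, ∑ m ∈ s, (a n ^ 2 * c n m + a m ^ 2 * c n m) / 2 := by
        refine sum_le_sum fun n _ => sum_le_sum fun m _ => ?_
        nlinarith [mul_nonneg (sq_nonneg (a n - a m)) (hc n m)]
    _ = ∑ n ∈ s, ∑ m ∈ s, a n ^ 2 * c n m := by
        simp_rw [← sum_div, sum_add_distrib]
        rw [hswap, add_self_div_two]
    _ = ∑ n ∈ s, a n ^ 2 * ∑ m ∈ s, c n m := by simp_rw [mul_sum]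
    _ ≤ ∑ n ∈ s, a n ^ 2 * M :=
        sum_le_sum fun n hn => mul_le_mul_of_nonneg_left (hM n hn) (sq_nonneg _)
    _ = M * ∑ n ∈ s, a n ^ 2 := by rw [← sum_mul, mul_comm]

lemma sum_one_div_abs_sub_le {s : Finset ℕ} {K n : ℕ} (hs : ∀ m ∈ s, m ≤ K) (hn : n ≤ K) :
    ∑ m ∈ s with m ≠ n, 1 / |(n : ℝ) - m| ≤ 2 * ∑ k ∈ Icc 1 K, 1 / (k : ℝ) := by
  have hbelow : ∑ m ∈ s with m < n, 1 / |(n : ℝ) - m| ≤ ∑ k ∈ Icc 1 K, 1 / (k : ℝ) := by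
    calc ∑ m ∈ s with m < n, 1 / |(n : ℝ) - m|
        = ∑ m ∈ s with m < n, 1 / ((n - m : ℕ) : ℝ) := by
          refine sum_congr rfl fun m hm => ?_
          have hlt := (mem_filter.1 hm).2
          rw [Nat.cast_sub hlt.le, abs_of_pos (sub_pos.2 (Nat.cast_lt.2 hlt))]
      _ = ∑ k ∈ (s.filter (· < n)).image (n - ·), 1 / (k : ℝ) := by
          rw [sum_image]
          intro x hx y hy h
          simp only [coe_filter, Set.mem_ofPred_eq] at hx hy h
          omega
      _ ≤ ∑ k ∈ Icc 1 K, 1 / (k : ℝ) := by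
          refine sum_le_sum_of_subset_of_nonneg ?_ fun k _ _ => by positivity
          intro k hk
          simp only [mem_image, mem_filter, mem_Icc] at hk ⊢
          obtain ⟨m, ⟨_, _⟩, rfl⟩ := hk
          omega
  have habove : ∑ m ∈ s with n < m, 1 / |(n : ℝ) - m| ≤ ∑ k ∈ Icc 1 K, 1 / (k : ℝ) := by
    calc ∑ m ∈ s with n < m, 1 / |(n : ℝ) - m|
        = ∑ m ∈ s with n < m, 1 / ((m - n : ℕ) : ℝ) := by
          refine sum_congr rfl fun m hm => ?_
          have hlt := (mem_filter.1 hm).2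
          rw [Nat.cast_sub hlt.le, abs_sub_comm, abs_of_pos (sub_pos.2 (Nat.cast_lt.2 hlt))]
      _ = ∑ k ∈ (s.filter (n < ·)).image (· - n), 1 / (k : ℝ) := by
          rw [sum_image]
          intro x hx y hy h
          simp only [coe_filter, Set.mem_ofPred_eq] at hx hy h
          omega
      _ ≤ ∑ k ∈ Icc 1 K, 1 / (k : ℝ) := by
          refine sum_le_sum_of_subset_of_nonneg ?_ fun k _ _ => by positivity
          intro k hk
          simp only [mem_image, mem_filter, mem_Icc] at hk ⊢
          obtain ⟨m, ⟨hm, _⟩, rfl⟩ := hk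
          have := hs m hm
          omega
  have hsplit : s.filter (· ≠ n) = s.filter (· < n) ∪ s.filter (n < ·) := by
    rw [← filter_or]
    exact filter_congr fun m _ => by simp [lt_or_lt_iff_ne]
  have hdisj : Disjoint (s.filter (· < n)) (s.filter (n < ·)) :=
    disjoint_filter.2 fun m _ h => h.asymm
  rw [hsplit, sum_union hdisj, two_mul]
  exact add_le_add hbelow habove

lemma integral_norm_sum_rpow_two_thirds_sq_le {A B : ℝ} (hAB : A ≤ B) {s : Finset ℕ} {K : ℕ}
    (hs : ∀ m ∈ s, m ≤ K) {a : ℕ → ℝ} (ha : ∀ n, 0 ≤ a n) :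
    ∫ α in A..B, ‖∑ n ∈ s, (a n : ℂ) * exp (I * α * ((n : ℝ) ^ ((2 : ℝ) / 3) : ℝ))‖ ^ 2 ≤
      (B - A + 4 * (K : ℝ) ^ ((1 : ℝ) / 3) * (2 * ∑ k ∈ Icc 1 K, 1 / (k : ℝ))) *
        ∑ n ∈ s, a n ^ 2 := by
  set c : ℕ → ℕ → ℝ := fun n m =>
    if m = n then B - A else 4 * (K : ℝ) ^ ((1 : ℝ) / 3) * (1 / |(n : ℝ) - m|) with hc
  have hexpand (α : ℝ) :
      ‖∑ n ∈ s, (a n : ℂ) * exp (I * α * ((n : ℝ) ^ ((2 : ℝ) / 3) : ℝ))‖ ^ 2 =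
        ∑ n ∈ s, ∑ m ∈ s, a n * a m *
          Real.cos (α * ((n : ℝ) ^ ((2 : ℝ) / 3) - (m : ℝ) ^ ((2 : ℝ) / 3))) := by
    simp_rw [mul_sub, ← norm_sum_mul_exp_sq s a fun n => α * (n : ℝ) ^ ((2 : ℝ) / 3)]
    simp only [ofReal_mul, mul_assoc]
  have hcos (x : ℝ) : IntervalIntegrable (fun α => Real.cos (α * x)) MeasureTheory.volume A B := by
    apply Continuous.intervalIntegrable
    fun_prop
  simp_rw [hexpand]
  rw [intervalIntegral.integral_finsetSum fun n _ => by
    apply Continuous.intervalIntegrable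
    fun_prop]
  calc ∑ n ∈ s, ∫ α in A..B, ∑ m ∈ s, a n * a m *
          Real.cos (α * ((n : ℝ) ^ ((2 : ℝ) / 3) - (m : ℝ) ^ ((2 : ℝ) / 3)))
      = ∑ n ∈ s, ∑ m ∈ s, a n * a m * ∫ α in A..B,
          Real.cos (α * ((n : ℝ) ^ ((2 : ℝ) / 3) - (m : ℝ) ^ ((2 : ℝ) / 3))) := by
        refine sum_congr rfl fun n _ => ?_
        rw [intervalIntegral.integral_finsetSum fun m _ => (hcos _).const_mul _]
        simp_rw [intervalIntegral.integral_const_mul]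
    _ ≤ ∑ n ∈ s, ∑ m ∈ s, a n * a m * c n m := by
        refine sum_le_sum fun n hn => sum_le_sum fun m hm =>
          mul_le_mul_of_nonneg_left ?_ (mul_nonneg (ha n) (ha m))
        simp only [hc]
        split_ifs with h
        · exact integral_cos_mul_le_sub hAB _
        · exact integral_cos_rpow_two_thirds_le (Nat.cast_nonneg n) (Nat.cast_nonneg m)
            (Nat.cast_le.2 (hs n hn)) (Nat.cast_le.2 (hs m hm)) fun h' =>
              h (Nat.cast_injective h').symm
    _ ≤ _ := by
        refine sum_sum_mul_mul_le ?_ ?_ ?_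
        · intro n m
          simp only [hc]
          split_ifs
          · exact sub_nonneg.2 hAB
          · positivity
        · intro n m
          simp only [hc, eq_comm (a := m), abs_sub_comm (n : ℝ)]
        · intro n hn
          simp only [hc]
          rw [sum_ite, ← mul_sum, filter_eq' s n, if_pos hn, sum_singleton]
          have := sum_one_div_abs_sub_le hs (hs n hn)
          gcongr

lemma sum_Icc_one_div_le_log {N : ℕ} (hN : 2 ≤ N) :
    ∑ k ∈ Icc 1 (2 * N), 1 / (k : ℝ) ≤ 4 * Real.log N := by
  have h := harmonic_le_one_add_log (2 * N)
  rw [harmonic_eq_sum_Icc] at h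
  push_cast at h
  have hN0 : (N : ℝ) ≠ 0 := by positivity
  have hlog : Real.log 2 ≤ Real.log N := Real.log_le_log two_pos (by exact_mod_cast hN)
  rw [Real.log_mul two_ne_zero hN0] at h
  simp_rw [one_div]
  linarith [Real.log_two_gt_d9]

end

theorem mean_square_of_S (A B : ℝ) (hA : 0 < A) (hAB : A < B) :
    ∃ C : ℝ, 0 < C ∧ ∀ N : ℕ, 2 ≤ N → ∀ N' : ℕ, N < N' → N' ≤ 2 * N →
      (∫ α in A..B,
          ‖∑ n ∈ Finset.Ioc N N',
              (d3 n : ℂ) * Complex.exp (I * α * ((n : ℝ) ^ ((2 : ℝ) / 3) : ℝ))‖ ^ 2)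
        ≤ C * (N : ℝ) ^ ((4 : ℝ) / 3) * Real.log N ^ 9 := by
  have hBA : 0 < B - A := sub_pos.2 hAB
  refine ⟨2 * (B - A + 16) * 4 ^ 9, by positivity, fun N hN N' _ hN' => ?_⟩
  have hmem (n : ℕ) (hn : n ∈ Finset.Ioc N N') : n ≤ 2 * N := (Finset.mem_Ioc.1 hn).2.trans hN'
  have hmain := integral_norm_sum_rpow_two_thirds_sq_le hAB.le hmem
    (a := fun n => (d3 n : ℝ)) fun n => Nat.cast_nonneg _
  simp only [ofReal_natCast] at hmain
  refine hmain.trans ?_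
  set H := ∑ k ∈ Finset.Icc 1 (2 * N), 1 / (k : ℝ) with hH
  have hN1 : (1 : ℝ) ≤ N := by exact_mod_cast one_le_two.trans hN
  have hHlog : H ≤ 4 * Real.log N := sum_Icc_one_div_le_log hN
  have hH1 : 1 ≤ H := by
    have h1 : (1 : ℕ) ∈ Finset.Icc 1 (2 * N) := by
      rw [Finset.mem_Icc]
      omega
    have := Finset.single_le_sum (f := fun k : ℕ => 1 / (k : ℝ)) (fun k _ => by positivity) h1
    simpa [hH] using this
  have hsq : ∑ n ∈ Finset.Ioc N N', (d3 n : ℝ) ^ 2 ≤ 2 * N * H ^ 8 := by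
    calc ∑ n ∈ Finset.Ioc N N', (d3 n : ℝ) ^ 2
        ≤ ∑ n ∈ Finset.Ioc N N', tau3 n ^ 2 := by
          refine Finset.sum_le_sum fun n hn => pow_le_pow_left₀ (Nat.cast_nonneg _) ?_ 2
          exact d3_le_tau3 (Nat.ne_of_gt (pos_of_gt (Finset.mem_Ioc.1 hn).1))
      _ ≤ ∑ n ∈ Finset.Icc 1 (2 * N), tau3 n ^ 2 := by
          refine Finset.sum_le_sum_of_subset_of_nonneg ?_ fun n _ _ => sq_nonneg _
          intro n hn
          rw [Finset.mem_Ioc] at hn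
          rw [Finset.mem_Icc]
          omega
      _ ≤ 2 * N * H ^ 8 := by
          have := sum_tau3_sq_le (2 * N)
          push_cast at this
          exact this
  have hroot : ((2 * N : ℕ) : ℝ) ^ ((1 : ℝ) / 3) ≤ 2 * (N : ℝ) ^ ((1 : ℝ) / 3) := by
    push_cast
    rw [Real.mul_rpow two_pos.le (Nat.cast_nonneg N)]
    gcongr
    exact (Real.rpow_le_rpow_of_exponent_le one_le_two (by norm_num)).trans_eq (Real.rpow_one 2)
  have hroot1 : 1 ≤ (N : ℝ) ^ ((1 : ℝ) / 3) := Real.one_le_rpow hN1 (by norm_num)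
  have hpow : (N : ℝ) ^ ((4 : ℝ) / 3) = (N : ℝ) ^ ((1 : ℝ) / 3) * N := by
    rw [← Real.rpow_add_one (by positivity)]
    norm_num
  rw [hpow]
  set r := (N : ℝ) ^ ((1 : ℝ) / 3) with hr
  have hfactor : B - A + 4 * ((2 * N : ℕ) : ℝ) ^ ((1 : ℝ) / 3) * (2 * H) ≤
      (B - A + 16) * (r * H) := by
    have h1 : 1 ≤ r * H := one_le_mul_of_one_le_of_one_le hroot1 hH1
    have h2 : (B - A) * 1 ≤ (B - A) * (r * H) := mul_le_mul_of_nonneg_left h1 hBA.le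
    have h3 := mul_le_mul_of_nonneg_right hroot (zero_le_one.trans hH1)
    linarith
  calc (B - A + 4 * ((2 * N : ℕ) : ℝ) ^ ((1 : ℝ) / 3) * (2 * H)) *
          ∑ n ∈ Finset.Ioc N N', (d3 n : ℝ) ^ 2
      ≤ (B - A + 16) * (r * H) * (2 * N * H ^ 8) := by gcongr
    _ = 2 * (B - A + 16) * (r * N) * H ^ 9 := by ring
    _ ≤ 2 * (B - A + 16) * (r * N) * (4 * Real.log N) ^ 9 := by gcongr
    _ = 2 * (B - A + 16) * 4 ^ 9 * (r * N) * Real.log N ^ 9 := by ring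
end

section
/- There exist constants C₁ > 0 and C₂ > 0 such that for all real x ≥ 2: |Σ_{n ≤ x} d₃(n)² − C₁ · x (log x)⁸| ≤ C₂ · x (log x)⁷. -/
open Finset ArithmeticFunction
open scoped ArithmeticFunction.zeta ArithmeticFunction.Moebius

theorem d3_eq_zeta_pow {n : ℕ} (hn : n ≠ 0) :
    (d3 n : ℝ) = ((ζ : ArithmeticFunction ℝ) ^ 3) n := by
  have hnat : d3 n = ((ζ : ArithmeticFunction ℕ) ^ 3) n := by
    have h3 : ((ζ : ArithmeticFunction ℕ) ^ 3) n
        = ∑ x ∈ n.divisorsAntidiagonal, ∑ y ∈ x.1.divisorsAntidiagonal, 1 := by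
      rw [pow_succ, pow_two, mul_apply]
      refine sum_congr rfl fun x hx => ?_
      have hx2 : x.2 ≠ 0 :=
        right_ne_zero_of_mul ((Nat.mem_divisorsAntidiagonal.1 hx).1.symm ▸ hn)
      rw [mul_apply, zeta_apply_ne hx2, mul_one]
      refine sum_congr rfl fun y hy => ?_
      obtain ⟨hy, hx1⟩ := Nat.mem_divisorsAntidiagonal.1 hy
      rw [← hy] at hx1
      rw [zeta_apply_ne (left_ne_zero_of_mul hx1), zeta_apply_ne (right_ne_zero_of_mul hx1),
        mul_one]
    rw [h3, sum_sigma', sum_const, smul_eq_mul, mul_one, d3]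
    refine card_bij' (fun p _ => (⟨(p.1 * p.2.1, p.2.2), (p.1, p.2.1)⟩ : (_ : ℕ × ℕ) × ℕ × ℕ))
      (fun q _ => (q.2.1, q.2.2, q.1.2)) ?_ ?_ ?_ ?_
    · rintro ⟨a, b, c⟩ h
      simp only [mem_filter] at h
      simp only [mem_sigma, Nat.mem_divisorsAntidiagonal, ne_eq, true_and]
      refine ⟨⟨h.2, hn⟩, fun h0 => hn ?_⟩
      rw [← h.2, h0, zero_mul]
    · rintro ⟨⟨a, b⟩, c, d⟩ h
      simp only [mem_sigma, Nat.mem_divisorsAntidiagonal] at h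
      obtain ⟨⟨h1, -⟩, h2, -⟩ := h
      have hprod : c * d * b = n := by rw [h2, h1]
      have hle : ∀ {k : ℕ}, k ∣ n → k < n + 1 := fun hk =>
        Nat.lt_succ_of_le (Nat.le_of_dvd (Nat.pos_of_ne_zero hn) hk)
      simp only [mem_filter, mem_product, mem_range]
      refine ⟨⟨hle ⟨d * b, ?_⟩, hle ⟨c * b, ?_⟩, hle ⟨c * d, ?_⟩⟩, hprod⟩ <;>
        rw [← hprod] <;> ring
    · rintro ⟨a, b, c⟩ h
      rfl
    · rintro ⟨⟨a, b⟩, c, d⟩ h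
      simp only [mem_sigma, Nat.mem_divisorsAntidiagonal] at h
      obtain ⟨⟨h1, -⟩, h2, -⟩ := h
      subst h2
      rfl
  have hcast : ((ζ : ArithmeticFunction ℝ) ^ 3) n = (((ζ : ArithmeticFunction ℕ) ^ 3) n : ℕ) := by
    rw [← natCoe_apply (R := ℝ), pow_succ, pow_two, pow_succ, pow_two, natCoe_mul, natCoe_mul]
  rw [hcast, hnat]

/-- The power series of the values of an arithmetic function at the powers of `p`. -/
noncomputable def bellSeries (p : ℕ) (f : ArithmeticFunction ℝ) : PowerSeries ℝ :=
  PowerSeries.mk fun k => f (p ^ k)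

theorem bellSeries_mul {p : ℕ} (hp : p.Prime) (f g : ArithmeticFunction ℝ) :
    bellSeries p (f * g) = bellSeries p f * bellSeries p g := by
  ext k
  simp only [bellSeries, PowerSeries.coeff_mul, PowerSeries.coeff_mk]
  rw [mul_apply, Nat.sum_divisorsAntidiagonal (fun a b => f a * g b), Nat.sum_divisors_prime_pow hp,
    Finset.Nat.sum_antidiagonal_eq_sum_range_succ (fun a b => f (p ^ a) * g (p ^ b))]
  refine sum_congr rfl fun i hi => ?_
  rw [Nat.pow_div (by simpa [Nat.lt_succ_iff] using hi) hp.pos]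

theorem bellSeries_one {p : ℕ} (hp : p.Prime) : bellSeries p 1 = 1 := by
  ext k
  rcases eq_or_ne k 0 with rfl | hk
  · simp [bellSeries]
  · simp [bellSeries, PowerSeries.coeff_one, hk, one_apply, hp.ne_one]

theorem bellSeries_pow {p : ℕ} (hp : p.Prime) (f : ArithmeticFunction ℝ) (n : ℕ) :
    bellSeries p (f ^ n) = bellSeries p f ^ n := by
  induction n with
  | zero => simpa using bellSeries_one hp
  | succ n ih => rw [pow_succ, bellSeries_mul hp, ih, pow_succ]

theorem bellSeries_zeta {p : ℕ} (hp : p.Prime) :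
    bellSeries p (ζ : ArithmeticFunction ℝ) = PowerSeries.mk 1 := by
  ext k
  simp [bellSeries, natCoe_apply, zeta_apply, hp.ne_zero]

theorem bellSeries_moebius {p : ℕ} (hp : p.Prime) :
    bellSeries p (μ : ArithmeticFunction ℝ) = 1 - PowerSeries.X := by
  ext k
  rcases eq_or_ne k 0 with rfl | hk
  · simp [bellSeries]
  · by_cases h1 : k = 1 <;>
    simp [bellSeries, PowerSeries.coeff_one, PowerSeries.coeff_X, hk, intCoe_apply,
      moebius_apply_prime_pow hp hk, moebius_apply_prime hp, h1]

theorem bellSeries_zeta_pow_three_sq {p : ℕ} (hp : p.Prime) :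
    bellSeries p (((ζ : ArithmeticFunction ℝ) ^ 3).pmul ((ζ : ArithmeticFunction ℝ) ^ 3))
      = 6 * PowerSeries.mk 1 ^ 5 - 6 * PowerSeries.mk 1 ^ 4 + PowerSeries.mk 1 ^ 3 := by
  have h3 : ∀ k, ((ζ : ArithmeticFunction ℝ) ^ 3) (p ^ k) = (Nat.choose (2 + k) 2 : ℝ) := by
    intro k
    have := congrArg (PowerSeries.coeff k) (bellSeries_pow hp (ζ : ArithmeticFunction ℝ) 3)
    rw [bellSeries_zeta hp, PowerSeries.mk_one_pow_eq_mk_choose_add] at this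
    simpa [bellSeries] using this
  have h6 : (6 : PowerSeries ℝ) = PowerSeries.C 6 := (map_ofNat _ 6).symm
  ext k
  rw [PowerSeries.mk_one_pow_eq_mk_choose_add, PowerSeries.mk_one_pow_eq_mk_choose_add,
    PowerSeries.mk_one_pow_eq_mk_choose_add, h6]
  simp only [bellSeries, pmul_apply, h3, map_add, map_sub, PowerSeries.coeff_mk,
    PowerSeries.coeff_C_mul]
  rw [Nat.cast_add_choose, Nat.cast_add_choose, Nat.cast_add_choose, add_comm 2 k, add_comm 3 k,
    add_comm 4 k]
  simp only [Nat.factorial_succ, Nat.factorial_zero]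
  have : (k.factorial : ℝ) ≠ 0 := by positivity
  push_cast
  field_simp
  ring

/-- The Dirichlet quotient of `d₃²` by the ninefold divisor function. -/
noncomputable def d3SqQuotient : ArithmeticFunction ℝ :=
  ((ζ : ArithmeticFunction ℝ) ^ 3).pmul ((ζ : ArithmeticFunction ℝ) ^ 3) *
    (μ : ArithmeticFunction ℝ) ^ 9

theorem d3SqQuotient_mul_zeta_pow : d3SqQuotient * (ζ : ArithmeticFunction ℝ) ^ 9
    = ((ζ : ArithmeticFunction ℝ) ^ 3).pmul ((ζ : ArithmeticFunction ℝ) ^ 3) := by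
  rw [d3SqQuotient, mul_assoc, ← mul_pow, coe_moebius_mul_coe_zeta, one_pow, mul_one]

theorem isMultiplicative_d3SqQuotient : d3SqQuotient.IsMultiplicative := by
  have hz : (ζ : ArithmeticFunction ℝ).IsMultiplicative := isMultiplicative_zeta.natCast
  have hm : (μ : ArithmeticFunction ℝ).IsMultiplicative := isMultiplicative_moebius.intCast
  exact (hz.pow.pmul hz.pow).mul hm.pow

theorem bellSeries_d3SqQuotient {p : ℕ} (hp : p.Prime) :
    bellSeries p d3SqQuotient = 1 - PowerSeries.C 9 * PowerSeries.X ^ 2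
      + PowerSeries.C 16 * PowerSeries.X ^ 3 - PowerSeries.C 9 * PowerSeries.X ^ 4
      + PowerSeries.X ^ 6 := by
  rw [d3SqQuotient, bellSeries_mul hp, bellSeries_zeta_pow_three_sq hp, bellSeries_pow hp,
    bellSeries_moebius hp]
  have h : (PowerSeries.mk 1 : PowerSeries ℝ) * (1 - PowerSeries.X) = 1 :=
    PowerSeries.mk_one_mul_one_sub_eq_one ℝ
  have h9 : PowerSeries.C (9 : ℝ) = 9 := map_ofNat _ 9
  have h16 : PowerSeries.C (16 : ℝ) = 16 := map_ofNat _ 16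
  rw [h9, h16]
  generalize (PowerSeries.mk 1 : PowerSeries ℝ) = S at h
  generalize (PowerSeries.X : PowerSeries ℝ) = Y at h
  have e : (6 * S ^ 5 - 6 * S ^ 4 + S ^ 3) * (1 - Y) ^ 9
      = 6 * (S * (1 - Y)) ^ 5 * (1 - Y) ^ 4 - 6 * (S * (1 - Y)) ^ 4 * (1 - Y) ^ 5
        + (S * (1 - Y)) ^ 3 * (1 - Y) ^ 6 := by ring
  rw [e, h]
  ring

theorem d3SqQuotient_prime_pow {p : ℕ} (hp : p.Prime) (k : ℕ) :
    d3SqQuotient (p ^ k) = (if k = 0 then 1 else 0) - 9 * (if k = 2 then 1 else 0)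
      + 16 * (if k = 3 then 1 else 0) - 9 * (if k = 4 then 1 else 0) + if k = 6 then 1 else 0 := by
  have := congrArg (PowerSeries.coeff k) (bellSeries_d3SqQuotient hp)
  simpa only [bellSeries, PowerSeries.coeff_mk, map_add, map_sub, PowerSeries.coeff_C_mul,
    PowerSeries.coeff_X_pow, PowerSeries.coeff_one] using this

theorem summable_of_multiplicative {f b : ℕ → ℝ} (hf : ∀ n, 0 ≤ f n) (hf0 : f 0 = 0)
    (hf1 : f 1 = 1) (hmul : ∀ {m n : ℕ}, m.Coprime n → f (m * n) = f m * f n)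
    (hb : ∀ n, 0 ≤ b n) (hbs : Summable b)
    (hs : ∀ {p : ℕ}, p.Prime → Summable fun e : ℕ => f (p ^ e))
    (hle : ∀ {p : ℕ}, p.Prime → ∑' e : ℕ, f (p ^ e) ≤ 1 + b p) : Summable f := by
  refine summable_of_sum_range_le (c := Real.exp (∑' n, b n)) hf fun N => ?_
  have hsum := (EulerProduct.summable_and_hasSum_smoothNumbers_prod_primesBelow_tsum hf1 hmul
    (fun hp => by simpa only [Real.norm_of_nonneg (hf _)] using hs hp) N).2
  have hind := (hasSum_subtype_iff_indicator (s := N.smoothNumbers)).1 hsum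
  calc ∑ i ∈ range N, f i ≤ ∑ i ∈ range N, (N.smoothNumbers).indicator f i := by
        refine sum_le_sum fun i hi => ?_
        rcases Nat.eq_zero_or_pos i with rfl | h0
        · rw [hf0]
          exact Set.indicator_nonneg (fun n _ => hf n) _
        · rw [Set.indicator_of_mem
            (Nat.mem_smoothNumbers_of_lt h0 (mem_range.1 hi))]
    _ ≤ ∏ p ∈ N.primesBelow, ∑' e : ℕ, f (p ^ e) :=
        sum_le_hasSum _ (fun i _ => Set.indicator_nonneg (fun n _ => hf n) _) hind
    _ ≤ ∏ p ∈ N.primesBelow, Real.exp (b p) := by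
        refine prod_le_prod (fun p _ => tsum_nonneg fun e => hf _) fun p hp => ?_
        refine (hle (Nat.prime_of_mem_primesBelow hp)).trans ?_
        rw [add_comm]
        exact Real.add_one_le_exp _
    _ = Real.exp (∑ p ∈ N.primesBelow, b p) := (Real.exp_sum _ _).symm
    _ ≤ Real.exp (∑' n, b n) :=
        Real.exp_le_exp.2 (hbs.sum_le_tsum _ fun n _ => hb n)

theorem hasSum_abs_d3SqQuotient_prime_pow {p : ℕ} (hp : p.Prime) (y : ℝ) :
    HasSum (fun e : ℕ => |d3SqQuotient (p ^ e)| * y ^ e)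
      (1 + 9 * y ^ 2 + 16 * y ^ 3 + 9 * y ^ 4 + y ^ 6) := by
  have h : ∀ e ∉ range 7, |d3SqQuotient (p ^ e)| * y ^ e = 0 := by
    intro e he
    rw [mem_range, not_lt] at he
    rw [d3SqQuotient_prime_pow hp, if_neg (by omega), if_neg (by omega), if_neg (by omega),
      if_neg (by omega), if_neg (by omega)]
    simp
  have hsum : HasSum _ _ := hasSum_sum_of_ne_finset_zero h
  convert hsum using 1
  simp only [d3SqQuotient_prime_pow hp, sum_range_succ, range_zero, sum_empty]
  norm_num

theorem hasSum_d3SqQuotient_prime_pow {p : ℕ} (hp : p.Prime) (y : ℝ) :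
    HasSum (fun e : ℕ => d3SqQuotient (p ^ e) * y ^ e)
      (1 + (-9 * y ^ 2 + 16 * y ^ 3 - 9 * y ^ 4 + y ^ 6)) := by
  have h : ∀ e ∉ range 7, d3SqQuotient (p ^ e) * y ^ e = 0 := by
    intro e he
    rw [mem_range, not_lt] at he
    rw [d3SqQuotient_prime_pow hp, if_neg (by omega), if_neg (by omega), if_neg (by omega),
      if_neg (by omega), if_neg (by omega)]
    simp
  have hsum : HasSum _ _ := hasSum_sum_of_ne_finset_zero h
  convert hsum using 1
  simp only [d3SqQuotient_prime_pow hp, sum_range_succ, range_zero, sum_empty]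
  norm_num
  ring

theorem summable_abs_d3SqQuotient_mul_rpow :
    Summable fun n : ℕ => |d3SqQuotient n| * (n : ℝ) ^ (-(3 / 4) : ℝ) := by
  have hpow : ∀ p e : ℕ, ((p ^ e : ℕ) : ℝ) ^ (-(3 / 4) : ℝ) = ((p : ℝ) ^ (-(3 / 4) : ℝ)) ^ e := by
    intro p e
    rw [Nat.cast_pow, ← Real.rpow_natCast_mul (Nat.cast_nonneg p), mul_comm,
      Real.rpow_mul_natCast (Nat.cast_nonneg p)]
  refine summable_of_multiplicative (b := fun n => 35 * (n : ℝ) ^ (-(3 / 2) : ℝ))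
    (fun n => by positivity) (by simp) (by simp [isMultiplicative_d3SqQuotient.map_one]) ?_
    (fun n => by positivity) ((Real.summable_nat_rpow.2 (by norm_num)).mul_left _) ?_ ?_
  · intro m n hmn
    rw [isMultiplicative_d3SqQuotient.map_mul_of_coprime hmn, abs_mul, Nat.cast_mul,
      Real.mul_rpow (Nat.cast_nonneg m) (Nat.cast_nonneg n)]
    ring
  · intro p hp
    simp only [hpow]
    exact (hasSum_abs_d3SqQuotient_prime_pow hp _).summable
  · intro p hp
    simp only [hpow]
    rw [(hasSum_abs_d3SqQuotient_prime_pow hp _).tsum_eq]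
    have hp1 : (1 : ℝ) ≤ p := by exact_mod_cast hp.one_lt.le
    have hsq : (p : ℝ) ^ (-(3 / 2) : ℝ) = ((p : ℝ) ^ (-(3 / 4) : ℝ)) ^ 2 := by
      rw [← Real.rpow_mul_natCast (Nat.cast_nonneg p)]
      norm_num
    have hy0 : 0 ≤ (p : ℝ) ^ (-(3 / 4) : ℝ) := by positivity
    have hy1 : (p : ℝ) ^ (-(3 / 4) : ℝ) ≤ 1 :=
      Real.rpow_le_one_of_one_le_of_nonpos hp1 (by norm_num)
    rw [hsq]
    generalize (p : ℝ) ^ (-(3 / 4) : ℝ) = y at hy0 hy1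
    have h3 : y ^ 3 ≤ y ^ 2 := pow_le_pow_of_le_one hy0 hy1 (by norm_num)
    have h4 : y ^ 4 ≤ y ^ 2 := pow_le_pow_of_le_one hy0 hy1 (by norm_num)
    have h6 : y ^ 6 ≤ y ^ 2 := pow_le_pow_of_le_one hy0 hy1 (by norm_num)
    linarith

theorem summable_abs_d3SqQuotient_div_mul_one_add_log :
    Summable fun n : ℕ => |d3SqQuotient n| / n * (1 + Real.log n) := by
  refine Summable.of_nonneg_of_le (fun n => ?_) (fun n => ?_)
    (summable_abs_d3SqQuotient_mul_rpow.mul_left 5)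
  · have := Real.log_natCast_nonneg n
    positivity
  · rcases Nat.eq_zero_or_pos n with rfl | hn
    · simp
    have hn1 : (1 : ℝ) ≤ n := by exact_mod_cast hn
    have hlog := Real.log_le_rpow_div (Nat.cast_nonneg n) (show (0 : ℝ) < 1 / 4 by norm_num)
    have hone : (1 : ℝ) ≤ (n : ℝ) ^ (1 / 4 : ℝ) := Real.one_le_rpow hn1 (by norm_num)
    have hsplit : (n : ℝ) ^ (-(3 / 4) : ℝ) = (n : ℝ) ^ (1 / 4 : ℝ) / n := by
      rw [show (-(3 / 4) : ℝ) = 1 / 4 - 1 by norm_num, Real.rpow_sub_one (by positivity)]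
    have hle : 1 + Real.log n ≤ 5 * (n : ℝ) ^ (1 / 4 : ℝ) := by linarith
    rw [hsplit]
    calc |d3SqQuotient n| / n * (1 + Real.log n)
        ≤ |d3SqQuotient n| / n * (5 * (n : ℝ) ^ (1 / 4 : ℝ)) := by gcongr
      _ = _ := by ring

theorem summable_abs_d3SqQuotient_div : Summable fun n : ℕ => |d3SqQuotient n| / n := by
  refine Summable.of_nonneg_of_le (fun n => by positivity) (fun n => ?_)
    summable_abs_d3SqQuotient_div_mul_one_add_log
  have := Real.log_natCast_nonneg n
  exact le_mul_of_one_le_right (by positivity) (by linarith)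

theorem tsum_d3SqQuotient_div_pos : 0 < ∑' n : ℕ, d3SqQuotient n / n := by
  have hmul : ∀ {m n : ℕ}, m.Coprime n → d3SqQuotient (m * n) / ((m * n : ℕ) : ℝ)
      = d3SqQuotient m / m * (d3SqQuotient n / n) := by
    intro m n hmn
    rw [isMultiplicative_d3SqQuotient.map_mul_of_coprime hmn, Nat.cast_mul, mul_div_mul_comm]
  have hprod := EulerProduct.eulerProduct_tprod (f := fun n : ℕ => d3SqQuotient n / n)
    (by simp [isMultiplicative_d3SqQuotient.map_one]) hmul
    (by simpa using summable_abs_d3SqQuotient_div) (by simp)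
  have hlocal : ∀ p : Nat.Primes, ∑' e : ℕ, d3SqQuotient ((p : ℕ) ^ e) / (((p : ℕ) ^ e : ℕ) : ℝ)
      = 1 + (-9 * ((p : ℕ) : ℝ)⁻¹ ^ 2 + 16 * ((p : ℕ) : ℝ)⁻¹ ^ 3 - 9 * ((p : ℕ) : ℝ)⁻¹ ^ 4
        + ((p : ℕ) : ℝ)⁻¹ ^ 6) := by
    intro p
    rw [← (hasSum_d3SqQuotient_prime_pow p.2 _).tsum_eq]
    refine tsum_congr fun e => ?_
    rw [Nat.cast_pow, div_eq_mul_inv, inv_pow]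
  rw [← hprod]
  simp only [hlocal]
  have hbound : ∀ p : Nat.Primes, 0 < ((p : ℕ) : ℝ)⁻¹ ∧ ((p : ℕ) : ℝ)⁻¹ < 1 := fun p =>
    ⟨by have := p.2.pos; positivity, inv_lt_one_of_one_lt₀ (by exact_mod_cast p.2.one_lt)⟩
  rw [← Real.rexp_tsum_eq_tprod]
  · exact Real.exp_pos _
  · intro p
    obtain ⟨h0, h1⟩ := hbound p
    generalize ((p : ℕ) : ℝ)⁻¹ = y at h0 h1
    have hfac : 1 + (-9 * y ^ 2 + 16 * y ^ 3 - 9 * y ^ 4 + y ^ 6)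
        = (1 - y) ^ 4 * (1 + 4 * y + y ^ 2) := by ring
    have : 0 < 1 - y := by linarith
    rw [hfac]
    positivity
  · refine Real.summable_log_one_add_of_summable ?_
    have hsq : Summable fun p : Nat.Primes => 35 * (((p : ℕ) : ℝ) ^ 2)⁻¹ :=
      ((Real.summable_nat_pow_inv.2 one_lt_two).comp_injective
        Nat.Primes.coe_nat_injective).mul_left _
    refine Summable.of_norm_bounded hsq fun p => ?_
    obtain ⟨h0, h1⟩ := hbound p
    rw [← inv_pow]
    generalize ((p : ℕ) : ℝ)⁻¹ = y at h0 h1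
    have h3 : y ^ 3 ≤ y ^ 2 := pow_le_pow_of_le_one h0.le h1.le (by norm_num)
    have h4 : y ^ 4 ≤ y ^ 2 := pow_le_pow_of_le_one h0.le h1.le (by norm_num)
    have h6 : y ^ 6 ≤ y ^ 2 := pow_le_pow_of_le_one h0.le h1.le (by norm_num)
    rw [Real.norm_eq_abs, abs_le]
    constructor <;> linarith [pow_pos h0 2, pow_pos h0 3, pow_pos h0 4, pow_pos h0 6]

theorem mul_pow_mul_sub_le_pow_sub_pow {a b : ℝ} (hb : 0 ≤ b) (hab : b ≤ a) (n : ℕ) :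
    (n + 1) * b ^ n * (a - b) ≤ a ^ (n + 1) - b ^ (n + 1) := by
  induction n with
  | zero => simp
  | succ n ih =>
    have h1 := mul_le_mul_of_nonneg_left ih hb
    have h2 : 0 ≤ (a ^ (n + 1) - b ^ (n + 1)) * (a - b) :=
      mul_nonneg (sub_nonneg.2 (pow_le_pow_left₀ hb hab _)) (sub_nonneg.2 hab)
    push_cast
    linear_combination h1 + h2

theorem pow_sub_pow_le_mul_pow_mul_sub {a b : ℝ} (hb : 0 ≤ b) (hab : b ≤ a) (n : ℕ) :
    a ^ (n + 1) - b ^ (n + 1) ≤ (n + 1) * a ^ n * (a - b) := by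
  induction n with
  | zero => simp
  | succ n ih =>
    have h1 := mul_le_mul_of_nonneg_left ih (hb.trans hab)
    have h2 : 0 ≤ (a ^ (n + 1) - b ^ (n + 1)) * (a - b) :=
      mul_nonneg (sub_nonneg.2 (pow_le_pow_left₀ hb hab _)) (sub_nonneg.2 hab)
    push_cast
    linear_combination h1 + h2

theorem sum_log_div_pow_bounds (j : ℕ) {x : ℝ} {N : ℕ} (hN : 1 ≤ N) (hNx : (N : ℝ) ≤ x) :
    (∑ m ∈ Ioc 0 N, Real.log (x / m) ^ j / m) - Real.log x ^ j
        ≤ (Real.log x ^ (j + 1) - Real.log (x / N) ^ (j + 1)) / (j + 1) ∧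
      (Real.log x ^ (j + 1) - Real.log (x / N) ^ (j + 1)) / (j + 1)
        ≤ (∑ m ∈ Ioc 0 N, Real.log (x / m) ^ j / m) - Real.log (x / N) ^ j / N := by
  induction N, hN using Nat.le_induction with
  | base => simp
  | succ N hN ih =>
    push_cast at hNx
    obtain ⟨ih1, ih2⟩ := ih (by linarith)
    have hN0 : (0 : ℝ) < N := by exact_mod_cast hN
    have hx : 0 < x := by linarith
    rw [sum_Ioc_succ_top (Nat.zero_le N)]
    have hb : 0 ≤ Real.log (x / (N + 1)) := Real.log_nonneg (by rw [le_div_iff₀] <;> linarith)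
    have hdiff : Real.log (x / N) - Real.log (x / (N + 1)) = Real.log ((N + 1) / N) := by
      rw [← Real.log_div (by positivity) (by positivity)]
      congr 1
      field_simp
    have hup : Real.log ((N + 1) / N : ℝ) ≤ 1 / N := by
      have := Real.log_le_sub_one_of_pos (show (0 : ℝ) < (N + 1) / N by positivity)
      calc _ ≤ _ := this
        _ = 1 / N := by field_simp; ring
    have hlow : 1 / (N + 1 : ℝ) ≤ Real.log ((N + 1) / N) := by
      have := Real.one_sub_inv_le_log_of_pos (show (0 : ℝ) < (N + 1) / N by positivity)
      calc 1 / (N + 1 : ℝ) = 1 - ((N + 1 : ℝ) / N)⁻¹ := by field_simp; ring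
        _ ≤ _ := this
    have hab : Real.log (x / (N + 1)) ≤ Real.log (x / N) := by
      have : (0 : ℝ) < 1 / (N + 1) := by positivity
      linarith
    push_cast
    generalize Real.log (x / (N + 1)) = b at *
    generalize Real.log (x / N) = a at *
    have h1 := mul_pow_mul_sub_le_pow_sub_pow hb hab j
    have h2 := pow_sub_pow_le_mul_pow_mul_sub hb hab j
    have h1' : b ^ j / (N + 1) ≤ (a ^ (j + 1) - b ^ (j + 1)) / (j + 1) := by
      rw [le_div_iff₀ (by positivity)]
      refine le_trans ?_ h1
      calc b ^ j / (N + 1) * (j + 1) = (j + 1) * b ^ j * (1 / (N + 1)) := by ring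
        _ ≤ (j + 1) * b ^ j * (a - b) := by
          rw [hdiff]
          gcongr
    have h2' : (a ^ (j + 1) - b ^ (j + 1)) / (j + 1) ≤ a ^ j / N := by
      rw [div_le_iff₀ (by positivity)]
      refine h2.trans ?_
      have ha := hb.trans hab
      calc (j + 1) * a ^ j * (a - b) ≤ (j + 1) * a ^ j * (1 / N) := by
            rw [hdiff]
            gcongr
        _ = a ^ j / N * (j + 1) := by ring
    have hsplit : (Real.log x ^ (j + 1) - b ^ (j + 1)) / (j + 1 : ℝ)
        = (Real.log x ^ (j + 1) - a ^ (j + 1)) / (j + 1)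
          + (a ^ (j + 1) - b ^ (j + 1)) / (j + 1) := by ring
    rw [hsplit]
    constructor <;> linarith

theorem abs_sum_log_div_pow_sub_le (j : ℕ) {x : ℝ} (hx : 1 ≤ x) :
    |(∑ m ∈ Ioc 0 ⌊x⌋₊, Real.log (x / m) ^ j / m) - Real.log x ^ (j + 1) / (j + 1)|
      ≤ 2 * (1 + Real.log x) ^ j := by
  have hN : 1 ≤ ⌊x⌋₊ := Nat.floor_pos.2 hx
  have hNx : (⌊x⌋₊ : ℝ) ≤ x := Nat.floor_le (by linarith)
  have hxN : x < ⌊x⌋₊ + 1 := Nat.lt_floor_add_one x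
  have hN' : (1 : ℝ) ≤ ⌊x⌋₊ := by exact_mod_cast hN
  obtain ⟨h1, h2⟩ := sum_log_div_pow_bounds j hN hNx
  have hb : 0 ≤ Real.log (x / ⌊x⌋₊) := Real.log_nonneg (by rw [le_div_iff₀] <;> linarith)
  have hb1 : Real.log (x / ⌊x⌋₊) ≤ 1 := by
    have := Real.log_le_sub_one_of_pos (show 0 < x / ⌊x⌋₊ by positivity)
    have h3 : x / ⌊x⌋₊ ≤ 2 := by rw [div_le_iff₀] <;> linarith
    linarith
  have hL : 0 ≤ Real.log x := Real.log_nonneg hx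
  have hLj : Real.log x ^ j ≤ (1 + Real.log x) ^ j := by gcongr; linarith
  have hone : (1 : ℝ) ≤ (1 + Real.log x) ^ j := one_le_pow₀ (by linarith)
  have hFN : Real.log (x / ⌊x⌋₊) ^ (j + 1) / (j + 1 : ℝ) ≤ 1 := by
    rw [div_le_one (by positivity)]
    have := pow_le_one₀ (n := j + 1) hb hb1
    have : (0 : ℝ) ≤ j := Nat.cast_nonneg j
    linarith
  have hFN0 : 0 ≤ Real.log (x / ⌊x⌋₊) ^ (j + 1) / (j + 1 : ℝ) := by positivity
  have hhN : 0 ≤ Real.log (x / ⌊x⌋₊) ^ j / (⌊x⌋₊ : ℝ) := by positivity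
  rw [sub_div] at h1 h2
  rw [abs_le]
  constructor <;> linarith

theorem abs_sum_comp_div_sub_le (j : ℕ) {A E : ℝ → ℝ}
    (hA : ∀ y, 1 ≤ y → |A y - y * Real.log y ^ j / j.factorial| ≤ E y) {x : ℝ} (hx : 1 ≤ x) :
    |(∑ m ∈ Ioc 0 ⌊x⌋₊, A (x / m)) - x * Real.log x ^ (j + 1) / (j + 1).factorial|
      ≤ (∑ m ∈ Ioc 0 ⌊x⌋₊, E (x / m)) + 2 * x * (1 + Real.log x) ^ j := by
  have hfac : (1 : ℝ) ≤ j.factorial := by exact_mod_cast Nat.succ_le_of_lt j.factorial_pos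
  have hsplit : (∑ m ∈ Ioc 0 ⌊x⌋₊, A (x / m)) - x * Real.log x ^ (j + 1) / (j + 1).factorial
      = (∑ m ∈ Ioc 0 ⌊x⌋₊, (A (x / m) - x / m * Real.log (x / m) ^ j / j.factorial))
        + x / j.factorial * ((∑ m ∈ Ioc 0 ⌊x⌋₊, Real.log (x / m) ^ j / m)
          - Real.log x ^ (j + 1) / (j + 1)) := by
    rw [sum_sub_distrib, mul_sub, mul_sum]
    have h1 : ∑ m ∈ Ioc 0 ⌊x⌋₊, x / m * Real.log (x / m) ^ j / j.factorial
        = ∑ m ∈ Ioc 0 ⌊x⌋₊, x / j.factorial * (Real.log (x / m) ^ j / m) :=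
      sum_congr rfl fun m _ => by ring
    have h2 : x * Real.log x ^ (j + 1) / (j + 1).factorial
        = x / j.factorial * (Real.log x ^ (j + 1) / (j + 1)) := by
      rw [Nat.factorial_succ]
      push_cast
      field_simp
    rw [h1, h2]
    ring
  rw [hsplit]
  refine (abs_add_le _ _).trans (add_le_add ?_ ?_)
  · refine (abs_sum_le_sum_abs _ _).trans (sum_le_sum fun m hm => hA _ ?_)
    obtain ⟨hm0, hm⟩ := mem_Ioc.1 hm
    have : (0 : ℝ) < m := by exact_mod_cast hm0
    rw [le_div_iff₀ this, one_mul]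
    exact (Nat.le_floor_iff (by linarith)).1 hm
  · have hL := Real.log_nonneg hx
    rw [abs_mul, abs_of_nonneg (show 0 ≤ x / j.factorial by positivity)]
    calc _ ≤ x * (2 * (1 + Real.log x) ^ j) :=
          mul_le_mul (div_le_self (by linarith) hfac) (abs_sum_log_div_pow_sub_le j hx)
            (abs_nonneg _) (by linarith)
      _ = _ := by ring

theorem sum_mul_eq_sum_sum_div (f g : ArithmeticFunction ℝ) (x : ℝ) :
    ∑ n ∈ Ioc 0 ⌊x⌋₊, (f * g) n
      = ∑ m ∈ Ioc 0 ⌊x⌋₊, f m * ∑ n ∈ Ioc 0 ⌊x / m⌋₊, g n := by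
  simp only [sum_Ioc_mul_eq_sum_sum, Nat.floor_div_natCast]

theorem sum_zeta_pow_succ (k : ℕ) (x : ℝ) :
    ∑ n ∈ Ioc 0 ⌊x⌋₊, ((ζ : ArithmeticFunction ℝ) ^ (k + 1)) n
      = ∑ m ∈ Ioc 0 ⌊x⌋₊, ∑ n ∈ Ioc 0 ⌊x / m⌋₊, ((ζ : ArithmeticFunction ℝ) ^ k) n := by
  rw [pow_succ', sum_mul_eq_sum_sum_div]
  refine sum_congr rfl fun m hm => ?_
  rw [natCoe_apply, zeta_apply_ne (mem_Ioc.1 hm).1.ne', Nat.cast_one, one_mul]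

theorem sum_zeta (x : ℝ) : ∑ n ∈ Ioc 0 ⌊x⌋₊, ((ζ : ArithmeticFunction ℝ) ^ 1) n = ⌊x⌋₊ := by
  simp only [pow_one, natCoe_apply]
  exact_mod_cast sum_Ioc_zeta ⌊x⌋₊

theorem sum_inv_le_one_add_log {x : ℝ} (hx : 1 ≤ x) :
    ∑ m ∈ Ioc 0 ⌊x⌋₊, (m : ℝ)⁻¹ ≤ 1 + Real.log x := by
  have := harmonic_floor_le_one_add_log x hx
  rw [harmonic_eq_sum_Icc] at this
  push_cast at this
  exact this

theorem exists_abs_sum_zeta_pow_sub_le (k : ℕ) : ∃ C : ℝ, 0 ≤ C ∧ ∀ x : ℝ, 1 ≤ x →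
    |(∑ n ∈ Ioc 0 ⌊x⌋₊, ((ζ : ArithmeticFunction ℝ) ^ (k + 2)) n)
      - x * Real.log x ^ (k + 1) / (k + 1).factorial| ≤ C * x * (1 + Real.log x) ^ k := by
  induction k with
  | zero =>
    refine ⟨3, by norm_num, fun x hx => ?_⟩
    rw [sum_zeta_pow_succ]
    refine (abs_sum_comp_div_sub_le 0 (E := fun _ => 1)
      (A := fun y => ∑ n ∈ Ioc 0 ⌊y⌋₊, ((ζ : ArithmeticFunction ℝ) ^ 1) n) ?_ hx).trans ?_
    · intro y hy
      rw [sum_zeta]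
      have h1 := Nat.floor_le (show 0 ≤ y by linarith)
      have h2 := Nat.lt_floor_add_one y
      simp only [pow_zero, Nat.factorial_zero, Nat.cast_one, mul_one, div_one]
      rw [abs_le]
      constructor <;> linarith
    · have := Nat.floor_le (show 0 ≤ x by linarith)
      simp only [sum_const, Nat.card_Ioc, Nat.sub_zero, nsmul_eq_mul, mul_one, pow_zero]
      linarith
  | succ k ih =>
    obtain ⟨C, hC, h⟩ := ih
    refine ⟨C + 2, by linarith, fun x hx => ?_⟩
    have hL := Real.log_nonneg hx
    rw [sum_zeta_pow_succ]
    refine (abs_sum_comp_div_sub_le (k + 1) h hx).trans ?_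
    have hsum : ∑ m ∈ Ioc 0 ⌊x⌋₊, C * (x / m) * (1 + Real.log (x / m)) ^ k
        ≤ C * x * (1 + Real.log x) ^ (k + 1) := by
      calc _ ≤ ∑ m ∈ Ioc 0 ⌊x⌋₊, C * x * (1 + Real.log x) ^ k * (m : ℝ)⁻¹ := by
            refine sum_le_sum fun m hm => ?_
            obtain ⟨hm0, hm⟩ := mem_Ioc.1 hm
            have hm1 : (1 : ℝ) ≤ m := by exact_mod_cast hm0
            have hmx : (m : ℝ) ≤ x := (Nat.le_floor_iff (by linarith)).1 hm
            have hxm : 1 ≤ x / m := by rw [le_div_iff₀] <;> linarith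
            have hlog0 := Real.log_nonneg hxm
            have hlog : Real.log (x / m) ≤ Real.log x :=
              Real.log_le_log (by linarith) (div_le_self (by linarith) hm1)
            calc C * (x / m) * (1 + Real.log (x / m)) ^ k
                ≤ C * (x / m) * (1 + Real.log x) ^ k := by gcongr
              _ = _ := by ring
        _ ≤ C * x * (1 + Real.log x) ^ k * (1 + Real.log x) := by
            rw [← mul_sum]
            gcongr
            exact sum_inv_le_one_add_log hx
        _ = _ := by ring
    calc _ ≤ C * x * (1 + Real.log x) ^ (k + 1) + 2 * x * (1 + Real.log x) ^ (k + 1) := by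
          gcongr
      _ = _ := by ring

theorem abs_sum_d3SqQuotient_log_sub_le {x : ℝ} (hx : 1 ≤ x) :
    |(∑ m ∈ Ioc 0 ⌊x⌋₊, d3SqQuotient m / m * Real.log (x / m) ^ 8)
        - (∑' m : ℕ, d3SqQuotient m / m) * Real.log x ^ 8|
      ≤ (∑' m : ℕ, |d3SqQuotient m| / m * (1 + Real.log m)) * (8 * Real.log x ^ 7) := by
  have hL := Real.log_nonneg hx
  have hG : Summable fun m : ℕ => d3SqQuotient m / m :=
    Summable.of_norm (by simpa using summable_abs_d3SqQuotient_div)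
  have hfin : HasSum
      (fun m : ℕ => if m ∈ Ioc 0 ⌊x⌋₊ then d3SqQuotient m / m * Real.log (x / m) ^ 8 else 0)
      (∑ m ∈ Ioc 0 ⌊x⌋₊, d3SqQuotient m / m * Real.log (x / m) ^ 8) := by
    rw [← sum_congr rfl fun m hm => if_pos (c := m ∈ Ioc 0 ⌊x⌋₊) hm]
    exact hasSum_sum_of_ne_finset_zero fun m hm => if_neg hm
  rw [← Real.norm_eq_abs]
  refine (hfin.sub (hG.hasSum.mul_right _)).norm_le_of_bounded
    (summable_abs_d3SqQuotient_div_mul_one_add_log.hasSum.mul_right _) fun m => ?_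
  rcases Nat.eq_zero_or_pos m with rfl | hm0
  · simp
  have hm1 : (1 : ℝ) ≤ m := by exact_mod_cast hm0
  have hlm := Real.log_nonneg hm1
  have key : ∀ t : ℝ, |t - Real.log x ^ 8| ≤ 8 * Real.log x ^ 7 * Real.log m →
      |d3SqQuotient m / m * t - d3SqQuotient m / m * Real.log x ^ 8|
        ≤ |d3SqQuotient m| / m * (1 + Real.log m) * (8 * Real.log x ^ 7) := by
    intro t ht
    rw [← mul_sub, abs_mul, abs_div, Nat.abs_cast, mul_assoc]
    gcongr
    refine ht.trans ?_
    have : 0 ≤ Real.log x ^ 7 := by positivity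
    linarith
  rw [Real.norm_eq_abs]
  split_ifs with hm
  · have hmx : (m : ℝ) ≤ x := (Nat.le_floor_iff (by linarith)).1 (mem_Ioc.1 hm).2
    have hlog : Real.log (x / m) = Real.log x - Real.log m :=
      Real.log_div (by linarith) (by linarith)
    have hle : Real.log m ≤ Real.log x := Real.log_le_log (by linarith) hmx
    refine key _ ?_
    rw [hlog]
    have hb : 0 ≤ Real.log x - Real.log m := by linarith
    have hab : Real.log x - Real.log m ≤ Real.log x := by linarith
    have h1 := pow_sub_pow_le_mul_pow_mul_sub hb hab 7
    have h2 := pow_le_pow_left₀ hb hab 8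
    rw [abs_sub_comm, abs_of_nonneg (by linarith)]
    calc _ ≤ _ := h1
      _ = _ := by push_cast; ring
  · have hmx : x ≤ m := by
      have : ⌊x⌋₊ < m := by simpa [hm0] using hm
      exact ((Nat.floor_lt (by linarith)).1 this).le
    have hle : Real.log x ≤ Real.log m := Real.log_le_log (by linarith) hmx
    have h0 := key 0 (by
      rw [zero_sub, abs_neg, abs_of_nonneg (by positivity)]
      calc Real.log x ^ 8 = Real.log x ^ 7 * Real.log x := by ring
        _ ≤ Real.log x ^ 7 * Real.log m := by gcongr
        _ ≤ 8 * (Real.log x ^ 7 * Real.log m) := by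
          have : 0 ≤ Real.log x ^ 7 * Real.log m := by positivity
          linarith
        _ = _ := by ring)
    simpa using h0

theorem sum_d3_sq_eq (x : ℝ) : ∑ n ∈ Icc 1 ⌊x⌋₊, (d3 n : ℝ) ^ 2
    = ∑ m ∈ Ioc 0 ⌊x⌋₊,
        d3SqQuotient m * ∑ n ∈ Ioc 0 ⌊x / m⌋₊, ((ζ : ArithmeticFunction ℝ) ^ 9) n := by
  rw [← sum_mul_eq_sum_sum_div, d3SqQuotient_mul_zeta_pow]
  refine sum_congr rfl fun n hn => ?_
  rw [pmul_apply, ← d3_eq_zeta_pow (by have := (mem_Icc.1 hn).1; omega), pow_two]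

theorem sum_d3_sq_asymptotic :
    ∃ C₁ C₂ : ℝ, 0 < C₁ ∧ 0 < C₂ ∧ ∀ x : ℝ, 2 ≤ x →
      |(∑ n ∈ Finset.Icc 1 ⌊x⌋₊, (d3 n : ℝ) ^ 2) - C₁ * x * Real.log x ^ 8|
        ≤ C₂ * x * Real.log x ^ 7 := by
  obtain ⟨C, hC, hS⟩ := exists_abs_sum_zeta_pow_sub_le 7
  set G := ∑' m : ℕ, d3SqQuotient m / m
  set K := ∑' m : ℕ, |d3SqQuotient m| / m
  set M := ∑' m : ℕ, |d3SqQuotient m| / m * (1 + Real.log m)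
  have hK0 : 0 ≤ K := tsum_nonneg fun m => by positivity
  have hM0 : 0 ≤ M := tsum_nonneg fun m => by
    have := Real.log_natCast_nonneg m
    positivity
  refine ⟨G / Nat.factorial 8, 2187 * C * K + M + 1,
    div_pos tsum_d3SqQuotient_div_pos (by positivity), by positivity, fun x hx => ?_⟩
  have hx1 : 1 ≤ x := by linarith
  have hL0 := Real.log_nonneg hx1
  have hL3 : 1 + Real.log x ≤ 3 * Real.log x := by
    have := Real.log_le_log two_pos hx
    linarith [Real.log_two_gt_d9]
  have hsplit : (∑ n ∈ Icc 1 ⌊x⌋₊, (d3 n : ℝ) ^ 2) - G / Nat.factorial 8 * x * Real.log x ^ 8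
      = (∑ m ∈ Ioc 0 ⌊x⌋₊, d3SqQuotient m *
          ((∑ n ∈ Ioc 0 ⌊x / m⌋₊, ((ζ : ArithmeticFunction ℝ) ^ 9) n)
            - x / m * Real.log (x / m) ^ 8 / Nat.factorial 8))
        + x / Nat.factorial 8 *
          ((∑ m ∈ Ioc 0 ⌊x⌋₊, d3SqQuotient m / m * Real.log (x / m) ^ 8)
            - G * Real.log x ^ 8) := by
    rw [sum_d3_sq_eq, mul_sub (x / (Nat.factorial 8 : ℝ)), mul_sum]
    simp only [mul_sub]
    rw [sum_sub_distrib]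
    have h : ∑ m ∈ Ioc 0 ⌊x⌋₊,
          d3SqQuotient m * (x / m * Real.log (x / m) ^ 8 / Nat.factorial 8)
        = ∑ m ∈ Ioc 0 ⌊x⌋₊,
          x / Nat.factorial 8 * (d3SqQuotient m / m * Real.log (x / m) ^ 8) :=
      sum_congr rfl fun m _ => by ring
    rw [h]
    ring
  have hfirst : |∑ m ∈ Ioc 0 ⌊x⌋₊, d3SqQuotient m *
      ((∑ n ∈ Ioc 0 ⌊x / m⌋₊, ((ζ : ArithmeticFunction ℝ) ^ 9) n)
        - x / m * Real.log (x / m) ^ 8 / Nat.factorial 8)|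
      ≤ C * x * (1 + Real.log x) ^ 7 * K := by
    calc _ ≤ ∑ m ∈ Ioc 0 ⌊x⌋₊, C * x * (1 + Real.log x) ^ 7 * (|d3SqQuotient m| / m) := by
          refine (abs_sum_le_sum_abs _ _).trans (sum_le_sum fun m hm => ?_)
          obtain ⟨hm0, hm⟩ := mem_Ioc.1 hm
          have hm1 : (1 : ℝ) ≤ m := by exact_mod_cast hm0
          have hmx : (m : ℝ) ≤ x := (Nat.le_floor_iff (by linarith)).1 hm
          have hxm : 1 ≤ x / m := by rw [le_div_iff₀] <;> linarith
          have hlog0 := Real.log_nonneg hxm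
          have hlog : Real.log (x / m) ≤ Real.log x :=
            Real.log_le_log (by linarith) (div_le_self (by linarith) hm1)
          rw [abs_mul]
          calc _ ≤ |d3SqQuotient m| * (C * (x / m) * (1 + Real.log (x / m)) ^ 7) := by
                gcongr
                exact hS _ hxm
            _ ≤ |d3SqQuotient m| * (C * (x / m) * (1 + Real.log x) ^ 7) := by gcongr
            _ = _ := by ring
      _ ≤ _ := by
          rw [← mul_sum]
          gcongr
          exact summable_abs_d3SqQuotient_div.sum_le_tsum _ fun m _ => by positivity
  rw [hsplit]
  refine (abs_add_le _ _).trans ?_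
  rw [abs_mul, abs_of_nonneg (show 0 ≤ x / (Nat.factorial 8 : ℝ) by positivity)]
  calc _ ≤ C * x * (3 * Real.log x) ^ 7 * K
          + x / Nat.factorial 8 * (M * (8 * Real.log x ^ 7)) := by
        gcongr
        · exact hfirst.trans (by gcongr)
        · exact abs_sum_d3SqQuotient_log_sub_le hx1
    _ = (2187 * C * K + 8 / Nat.factorial 8 * M) * (x * Real.log x ^ 7) := by ring
    _ ≤ (2187 * C * K + M + 1) * (x * Real.log x ^ 7) := by
        refine mul_le_mul_of_nonneg_right ?_ (by positivity)
        have h8 : (8 : ℝ) / Nat.factorial 8 ≤ 1 := by norm_num [Nat.factorial]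
        have := mul_le_mul_of_nonneg_right h8 hM0
        linarith
    _ = _ := by ring
end

section
/- There exists an absolute constant C > 0 such that for every integer N ≥ 2: Σ_{N < m ≤ 2N} Σ_{N < n ≤ 2N, n ≠ m} d₃(m) d₃(n) / |m^{2/3} − n^{2/3}| ≤ C · N^{4/3} (log N)⁹. -/
open Real

open scoped Pointwise in
theorem zeta_mul_submultiplicative {f : ArithmeticFunction ℕ}
    (hf : ∀ a b, f (a * b) ≤ f a * f b) (a b : ℕ) :
    (ArithmeticFunction.zeta * f) (a * b) ≤
      (ArithmeticFunction.zeta * f) a * (ArithmeticFunction.zeta * f) b := by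
  simp only [ArithmeticFunction.zeta_mul_apply]
  rw [Nat.divisors_mul, Finset.sum_mul_sum, ← Finset.sum_product', Finset.mul_def]
  refine (Finset.sum_image_le_of_nonneg (fun _ _ => Nat.zero_le _)).trans ?_
  exact Finset.sum_le_sum fun p _ => hf _ _

theorem zeta_pow_submultiplicative (k a b : ℕ) :
    (ArithmeticFunction.zeta ^ k) (a * b) ≤
      (ArithmeticFunction.zeta ^ k) a * (ArithmeticFunction.zeta ^ k) b := by
  induction k generalizing a b with
  | zero =>
    simp only [pow_zero, ArithmeticFunction.one_apply, mul_eq_one]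
    split_ifs <;> simp_all
  | succ k ih =>
    rw [pow_succ']
    exact zeta_mul_submultiplicative ih a b

theorem zeta_pow_mul_zeta_pow_le (j k n : ℕ) :
    (ArithmeticFunction.zeta ^ j) n * (ArithmeticFunction.zeta ^ k) n ≤
      (ArithmeticFunction.zeta ^ (j * k)) n := by
  induction j generalizing n with
  | zero =>
    simp only [pow_zero, zero_mul, ArithmeticFunction.one_apply]
    split_ifs with h
    · subst h
      simpa using ((ArithmeticFunction.isMultiplicative_zeta.pow (k := k)).map_one).le
    · simp
  | succ j ih =>
    rw [pow_succ, add_mul, one_mul, pow_add, ArithmeticFunction.mul_apply,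
      ArithmeticFunction.mul_apply, Finset.sum_mul]
    refine Finset.sum_le_sum fun p hp => ?_
    obtain ⟨hp, hn⟩ := Nat.mem_divisorsAntidiagonal.1 hp
    have hz : ArithmeticFunction.zeta p.2 = 1 :=
      ArithmeticFunction.zeta_apply_ne fun h => hn (by rw [← hp, h, mul_zero])
    rw [hz, mul_one, ← hp]
    calc (ArithmeticFunction.zeta ^ j) p.1 * (ArithmeticFunction.zeta ^ k) (p.1 * p.2)
        ≤ (ArithmeticFunction.zeta ^ j) p.1 *
          ((ArithmeticFunction.zeta ^ k) p.1 * (ArithmeticFunction.zeta ^ k) p.2) :=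
          Nat.mul_le_mul_left _ (zeta_pow_submultiplicative k _ _)
      _ ≤ _ := by
          rw [← mul_assoc]
          exact Nat.mul_le_mul_right _ (ih _)

theorem d3_le_zeta_pow_three {n : ℕ} (hn : n ≠ 0) : d3 n ≤ (ArithmeticFunction.zeta ^ 3) n := by
  have h : (ArithmeticFunction.zeta ^ 3) n = (n.divisors.sigma fun d => d.divisors).card := by
    rw [pow_succ', pow_two, ArithmeticFunction.zeta_mul_apply, Finset.card_sigma]
    refine Finset.sum_congr rfl fun d _ => ?_
    rw [ArithmeticFunction.zeta_mul_apply, Finset.card_eq_sum_ones]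
    exact Finset.sum_congr rfl fun e he =>
      ArithmeticFunction.zeta_apply_ne (Nat.pos_of_mem_divisors he).ne'
  rw [h, d3]
  refine Finset.card_le_card_of_injOn (fun p => ⟨p.1 * p.2.1, p.1⟩) ?_ ?_
  · rintro ⟨a, b, c⟩ hp
    simp only [Finset.coe_filter, Set.mem_ofPred_eq] at hp
    obtain ⟨-, rfl⟩ := hp
    simp_all
  · rintro ⟨a, b, c⟩ hp ⟨a', b', c'⟩ hp' heq
    simp only [Finset.coe_filter, Set.mem_ofPred_eq] at hp hp'
    simp only [Sigma.mk.injEq, heq_eq_eq] at heq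
    obtain ⟨h1, rfl⟩ := heq
    have e1 := hp.2
    have e2 := hp'.2
    have ha : a ≠ 0 := by rintro rfl; simp at e1; omega
    have hb : b = b' := Nat.eq_of_mul_eq_mul_left (Nat.pos_of_ne_zero ha) h1
    subst hb
    have hab : a * b ≠ 0 := by intro h0; rw [h0] at e1; simp at e1; omega
    have hc : c = c' := Nat.eq_of_mul_eq_mul_left (Nat.pos_of_ne_zero hab) (e1.trans e2.symm)
    rw [hc]

theorem sum_inv_Ioc_le (X : ℕ) : ∑ n ∈ Finset.Ioc 0 X, (n : ℝ)⁻¹ ≤ 1 + Real.log X := by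
  have h := harmonic_le_one_add_log X
  rw [harmonic_eq_sum_Icc] at h
  push_cast at h
  exact h

theorem sum_zeta_pow_div_le (k X : ℕ) :
    ∑ n ∈ Finset.Ioc 0 X, ((ArithmeticFunction.zeta ^ k) n : ℝ) / n ≤
      (∑ n ∈ Finset.Ioc 0 X, (n : ℝ)⁻¹) ^ k := by
  induction k with
  | zero =>
    simp only [pow_zero, ArithmeticFunction.one_apply]
    calc ∑ n ∈ Finset.Ioc 0 X, (((if n = 1 then 1 else 0 : ℕ) : ℝ) / n)
        = ∑ n ∈ Finset.Ioc 0 X, (if n = 1 then (1 : ℝ) else 0) :=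
          Finset.sum_congr rfl fun n _ => by split_ifs with h <;> simp [h]
      _ ≤ 1 := by rw [Finset.sum_ite_eq']; split_ifs <;> norm_num
  | succ k ih =>
    let f : ArithmeticFunction ℝ := ⟨fun n => ((ArithmeticFunction.zeta ^ k) n : ℝ) / n, by simp⟩
    let g : ArithmeticFunction ℝ := ⟨fun n => (n : ℝ)⁻¹, by simp⟩
    have hfg : ∀ n, ((ArithmeticFunction.zeta ^ (k + 1)) n : ℝ) / n = (f * g) n := by
      intro n
      rw [pow_succ, ArithmeticFunction.mul_apply, ArithmeticFunction.mul_apply]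
      push_cast
      rw [Finset.sum_div]
      refine Finset.sum_congr rfl fun p hp => ?_
      obtain ⟨hp, hn⟩ := Nat.mem_divisorsAntidiagonal.1 hp
      have hz : ArithmeticFunction.zeta p.2 = 1 :=
        ArithmeticFunction.zeta_apply_ne fun h => hn (by rw [← hp, h, mul_zero])
      simp only [f, g, ArithmeticFunction.coe_mk, hz, ← hp]
      push_cast
      rw [mul_one, div_mul_eq_div_div, div_eq_mul_inv]
    calc ∑ n ∈ Finset.Ioc 0 X, ((ArithmeticFunction.zeta ^ (k + 1)) n : ℝ) / n
        = ∑ n ∈ Finset.Ioc 0 X, (f * g) n := Finset.sum_congr rfl fun n _ => hfg n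
      _ ≤ ∑ x ∈ Finset.Ioc 0 X ×ˢ Finset.Ioc 0 X, f x.1 * g x.2 := by
          rw [ArithmeticFunction.sum_Ioc_mul_eq_sum_prod_filter]
          refine Finset.sum_le_sum_of_subset_of_nonneg (Finset.filter_subset _ _) fun x _ _ => ?_
          simp only [f, g, ArithmeticFunction.coe_mk]
          positivity
      _ = (∑ n ∈ Finset.Ioc 0 X, ((ArithmeticFunction.zeta ^ k) n : ℝ) / n) *
            ∑ n ∈ Finset.Ioc 0 X, (n : ℝ)⁻¹ := by
          rw [Finset.sum_mul_sum, ← Finset.sum_product']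
          rfl
      _ ≤ _ := by
          rw [pow_succ]
          exact mul_le_mul_of_nonneg_right ih (Finset.sum_nonneg fun _ _ => by positivity)

theorem sum_zeta_pow_succ_le (k X : ℕ) :
    ∑ n ∈ Finset.Ioc 0 X, ((ArithmeticFunction.zeta ^ (k + 1)) n : ℝ) ≤
      X * (∑ n ∈ Finset.Ioc 0 X, (n : ℝ)⁻¹) ^ k := by
  have h := ArithmeticFunction.sum_Ioc_mul_zeta_eq_sum (ArithmeticFunction.zeta ^ k) X
  simp only [ArithmeticFunction.natCoe_nat, ← pow_succ] at h
  rw [← Nat.cast_sum, h]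
  push_cast
  refine le_trans ?_ (mul_le_mul_of_nonneg_left (sum_zeta_pow_div_le k X) (Nat.cast_nonneg X))
  rw [Finset.mul_sum]
  refine Finset.sum_le_sum fun n _ => ?_
  calc ((ArithmeticFunction.zeta ^ k) n : ℝ) * ((X / n : ℕ) : ℝ)
      ≤ ((ArithmeticFunction.zeta ^ k) n : ℝ) * ((X : ℝ) / n) :=
        mul_le_mul_of_nonneg_left Nat.cast_div_le (Nat.cast_nonneg _)
    _ = _ := by ring

theorem sum_d3_sq_le (X : ℕ) :
    ∑ n ∈ Finset.Ioc 0 X, (d3 n : ℝ) ^ 2 ≤ X * (1 + Real.log X) ^ 8 := by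
  calc ∑ n ∈ Finset.Ioc 0 X, (d3 n : ℝ) ^ 2
      ≤ ∑ n ∈ Finset.Ioc 0 X, ((ArithmeticFunction.zeta ^ (8 + 1)) n : ℝ) := by
        refine Finset.sum_le_sum fun n hn => ?_
        have h := d3_le_zeta_pow_three (Finset.mem_Ioc.1 hn).1.ne'
        have h' := (Nat.mul_le_mul h h).trans (zeta_pow_mul_zeta_pow_le 3 3 n)
        rw [sq]
        exact_mod_cast h'
    _ ≤ X * (∑ n ∈ Finset.Ioc 0 X, (n : ℝ)⁻¹) ^ 8 := sum_zeta_pow_succ_le 8 X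
    _ ≤ _ := by
        gcongr
        exact sum_inv_Ioc_le X

theorem sum_inv_abs_sub_le {S : Finset ℕ} {m X : ℕ} (hm : m ≤ X) (hS : S ⊆ Finset.Ioc 0 X) :
    ∑ n ∈ S.erase m, |(m : ℝ) - n|⁻¹ ≤ 2 * (1 + Real.log X) := by
  have hmaps : ∀ n ∈ S.erase m, ((m : ℤ) - n).natAbs ∈ Finset.Ioc 0 X := by
    intro n hn
    obtain ⟨hne, hnS⟩ := Finset.mem_erase.1 hn
    have := Finset.mem_Ioc.1 (hS hnS)
    rw [Finset.mem_Ioc]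
    omega
  calc ∑ n ∈ S.erase m, |(m : ℝ) - n|⁻¹
      = ∑ k ∈ Finset.Ioc 0 X, ∑ n ∈ (S.erase m).filter (fun n : ℕ => ((m : ℤ) - n).natAbs = k),
          |(m : ℝ) - n|⁻¹ := (Finset.sum_fiberwise_of_maps_to hmaps _).symm
    _ ≤ ∑ k ∈ Finset.Ioc 0 X, 2 * (k : ℝ)⁻¹ := by
        refine Finset.sum_le_sum fun k _ => ?_
        have hcard : ((S.erase m).filter (fun n : ℕ => ((m : ℤ) - n).natAbs = k)).card ≤ 2 := by
          refine (Finset.card_le_card (t := {m - k, m + k}) fun n hn => ?_).trans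
            Finset.card_le_two
          have := (Finset.mem_filter.1 hn).2
          simp only [Finset.mem_insert, Finset.mem_singleton]
          omega
        calc ∑ n ∈ (S.erase m).filter (fun n : ℕ => ((m : ℤ) - n).natAbs = k), |(m : ℝ) - n|⁻¹
            = ∑ n ∈ (S.erase m).filter (fun n : ℕ => ((m : ℤ) - n).natAbs = k), (k : ℝ)⁻¹ := by
              refine Finset.sum_congr rfl fun n hn => ?_
              rw [← (Finset.mem_filter.1 hn).2, Nat.cast_natAbs]
              push_cast
              rfl
          _ ≤ 2 * (k : ℝ)⁻¹ := by
              rw [Finset.sum_const, nsmul_eq_mul]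
              gcongr
              exact_mod_cast hcard
    _ ≤ _ := by
        rw [← Finset.mul_sum]
        gcongr
        exact sum_inv_Ioc_le X

theorem abs_sub_le_mul_abs_rpow_sub {x y Z : ℝ} (hx : 0 ≤ x) (hy : 0 ≤ y) (hxZ : x ≤ 2 * Z)
    (hyZ : y ≤ 2 * Z) :
    |x - y| ≤ 4 * Z ^ ((1 : ℝ) / 3) * |x ^ ((2 : ℝ) / 3) - y ^ ((2 : ℝ) / 3)| := by
  have hroot : ∀ t : ℝ, 0 ≤ t → t ≤ 2 * Z → ∃ u : ℝ, 0 ≤ u ∧ u ≤ 2 * Z ^ ((1 : ℝ) / 3) ∧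
      t = u ^ 3 ∧ t ^ ((2 : ℝ) / 3) = u ^ 2 := by
    intro t ht htZ
    have hZ : 0 ≤ Z := by linarith
    have h2 : (2 : ℝ) ^ ((1 : ℝ) / 3) ≤ 2 := by
      simpa using Real.rpow_le_rpow_of_exponent_le (x := 2) one_le_two
        (by norm_num : (1 : ℝ) / 3 ≤ 1)
    refine ⟨t ^ ((1 : ℝ) / 3), by positivity, ?_, ?_, ?_⟩
    · calc t ^ ((1 : ℝ) / 3) ≤ (2 * Z) ^ ((1 : ℝ) / 3) := by gcongr
        _ = 2 ^ ((1 : ℝ) / 3) * Z ^ ((1 : ℝ) / 3) := Real.mul_rpow two_pos.le hZ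
        _ ≤ _ := by gcongr
    · rw [← Real.rpow_natCast, ← Real.rpow_mul ht]; norm_num
    · rw [← Real.rpow_natCast, ← Real.rpow_mul ht]; norm_num
  obtain ⟨u, hu, huZ, hxu, hxu2⟩ := hroot x hx hxZ
  obtain ⟨v, hv, hvZ, hyv, hyv2⟩ := hroot y hy hyZ
  rw [hxu2, hyv2, hxu, hyv]
  have e1 : u ^ 3 - v ^ 3 = (u - v) * (u ^ 2 + u * v + v ^ 2) := by ring
  have e2 : u ^ 2 - v ^ 2 = (u - v) * (u + v) := by ring
  have huv : 0 ≤ u + v := by positivity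
  rw [e1, e2, abs_mul, abs_mul, abs_of_nonneg huv,
    abs_of_nonneg (by positivity : 0 ≤ u ^ 2 + u * v + v ^ 2)]
  have key : u ^ 2 + u * v + v ^ 2 ≤ 4 * Z ^ ((1 : ℝ) / 3) * (u + v) := by
    nlinarith [mul_nonneg hu hv, mul_le_mul_of_nonneg_right
      (by linarith : u + v ≤ 4 * Z ^ ((1 : ℝ) / 3)) huv]
  calc |u - v| * (u ^ 2 + u * v + v ^ 2)
      ≤ |u - v| * (4 * Z ^ ((1 : ℝ) / 3) * (u + v)) := by gcongr
    _ = _ := by ring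

theorem sum_erase_mul_mul_le {ι : Type*} [DecidableEq ι] (S : Finset ι) (a : ι → ℝ)
    (w : ι → ι → ℝ) (hw : ∀ i j, 0 ≤ w i j) (hsymm : ∀ i j, w i j = w j i) :
    ∑ i ∈ S, ∑ j ∈ S.erase i, a i * a j * w i j ≤
      ∑ i ∈ S, a i ^ 2 * ∑ j ∈ S.erase i, w i j := by
  have hswap : ∑ i ∈ S, ∑ j ∈ S.erase i, a j ^ 2 * w i j =
      ∑ i ∈ S, ∑ j ∈ S.erase i, a i ^ 2 * w i j := by
    rw [Finset.sum_comm' (t' := S) (s' := fun j => S.erase j)]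
    · exact Finset.sum_congr rfl fun i _ => Finset.sum_congr rfl fun j _ => by rw [hsymm]
    · intro i j
      simp only [Finset.mem_erase]
      tauto
  have hle : 2 * ∑ i ∈ S, ∑ j ∈ S.erase i, a i * a j * w i j ≤
      (∑ i ∈ S, ∑ j ∈ S.erase i, a i ^ 2 * w i j) +
        ∑ i ∈ S, ∑ j ∈ S.erase i, a j ^ 2 * w i j := by
    simp only [Finset.mul_sum, ← Finset.sum_add_distrib]
    refine Finset.sum_le_sum fun i _ => Finset.sum_le_sum fun j _ => ?_
    nlinarith [mul_nonneg (sq_nonneg (a i - a j)) (hw i j)]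
  have hfactor : ∑ i ∈ S, a i ^ 2 * ∑ j ∈ S.erase i, w i j =
      ∑ i ∈ S, ∑ j ∈ S.erase i, a i ^ 2 * w i j :=
    Finset.sum_congr rfl fun i _ => Finset.mul_sum _ _ _
  linarith

theorem one_add_log_two_mul_le {N : ℕ} (hN : 2 ≤ N) :
    1 + Real.log (2 * N : ℕ) ≤ 4 * Real.log N := by
  have h2 : Real.log 2 ≤ Real.log N :=
    Real.log_le_log two_pos (by exact_mod_cast hN)
  push_cast
  rw [Real.log_mul two_ne_zero (by positivity)]
  linarith [Real.log_two_gt_d9]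

theorem d3_offdiagonal_sum_bound :
    ∃ C : ℝ, 0 < C ∧ ∀ N : ℕ, 2 ≤ N →
      ∑ m ∈ Finset.Ioc N (2 * N), ∑ n ∈ (Finset.Ioc N (2 * N)).erase m,
          (d3 m : ℝ) * (d3 n : ℝ) / |(m : ℝ) ^ ((2 : ℝ) / 3) - (n : ℝ) ^ ((2 : ℝ) / 3)|
        ≤ C * (N : ℝ) ^ ((4 : ℝ) / 3) * Real.log N ^ 9 := by
  refine ⟨16 * 4 ^ 9, by norm_num, fun N hN => ?_⟩
  set S := Finset.Ioc N (2 * N)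
  have hsub : S ⊆ Finset.Ioc 0 (2 * N) := Finset.Ioc_subset_Ioc_left (Nat.zero_le N)
  have hle : ∀ n ∈ S, (n : ℝ) ≤ 2 * N := fun n hn => by exact_mod_cast (Finset.mem_Ioc.1 hn).2
  set L := 1 + Real.log (2 * N : ℕ)
  have hL0 : 0 ≤ L := add_nonneg zero_le_one (Real.log_natCast_nonneg _)
  have hinner : ∀ m ∈ S, ∑ n ∈ S.erase m,
      |(m : ℝ) ^ ((2 : ℝ) / 3) - (n : ℝ) ^ ((2 : ℝ) / 3)|⁻¹ ≤
        8 * (N : ℝ) ^ ((1 : ℝ) / 3) * L := by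
    intro m hm
    calc ∑ n ∈ S.erase m, |(m : ℝ) ^ ((2 : ℝ) / 3) - (n : ℝ) ^ ((2 : ℝ) / 3)|⁻¹
        ≤ ∑ n ∈ S.erase m, 4 * (N : ℝ) ^ ((1 : ℝ) / 3) * |(m : ℝ) - n|⁻¹ := by
          refine Finset.sum_le_sum fun n hn => ?_
          obtain ⟨hne, hnS⟩ := Finset.mem_erase.1 hn
          have hpos : 0 < |(m : ℝ) - n| :=
            abs_pos.2 (sub_ne_zero.2 (by exact_mod_cast hne.symm))
          have h := abs_sub_le_mul_abs_rpow_sub (Nat.cast_nonneg m) (Nat.cast_nonneg n)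
            (hle m hm) (hle n hnS)
          have hpos' : 0 < |(m : ℝ) ^ ((2 : ℝ) / 3) - (n : ℝ) ^ ((2 : ℝ) / 3)| :=
            pos_of_mul_pos_right (hpos.trans_le h) (by positivity)
          rw [← div_eq_mul_inv, le_div_iff₀ hpos, inv_mul_le_iff₀ hpos', mul_comm]
          exact h
      _ ≤ 4 * (N : ℝ) ^ ((1 : ℝ) / 3) * (2 * L) := by
          rw [← Finset.mul_sum]
          gcongr
          exact sum_inv_abs_sub_le (Finset.mem_Ioc.1 hm).2 hsub
      _ = _ := by ring
  have hsq : ∑ m ∈ S, (d3 m : ℝ) ^ 2 ≤ 2 * N * L ^ 8 := by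
    refine (Finset.sum_le_sum_of_subset_of_nonneg hsub fun _ _ _ => sq_nonneg _).trans ?_
    exact_mod_cast sum_d3_sq_le (2 * N)
  have hN43 : (N : ℝ) ^ ((4 : ℝ) / 3) = N * (N : ℝ) ^ ((1 : ℝ) / 3) := by
    have hN0 : (0 : ℝ) < N := by positivity
    rw [show (4 : ℝ) / 3 = 1 + 1 / 3 by norm_num, Real.rpow_add hN0, Real.rpow_one]
  simp only [div_eq_mul_inv _ |_ - _|]
  calc _ ≤ ∑ m ∈ S, (d3 m : ℝ) ^ 2 * ∑ n ∈ S.erase m,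
          |(m : ℝ) ^ ((2 : ℝ) / 3) - (n : ℝ) ^ ((2 : ℝ) / 3)|⁻¹ :=
        sum_erase_mul_mul_le S (fun m => (d3 m : ℝ))
          (fun m n => |(m : ℝ) ^ ((2 : ℝ) / 3) - (n : ℝ) ^ ((2 : ℝ) / 3)|⁻¹)
          (fun _ _ => by positivity) (fun _ _ => by rw [abs_sub_comm])
    _ ≤ ∑ m ∈ S, (d3 m : ℝ) ^ 2 * (8 * (N : ℝ) ^ ((1 : ℝ) / 3) * L) :=
        Finset.sum_le_sum fun m hm => mul_le_mul_of_nonneg_left (hinner m hm) (sq_nonneg _)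
    _ ≤ 2 * N * L ^ 8 * (8 * (N : ℝ) ^ ((1 : ℝ) / 3) * L) := by
        rw [← Finset.sum_mul]
        gcongr
    _ = 16 * (N : ℝ) ^ ((4 : ℝ) / 3) * L ^ 9 := by rw [hN43]; ring
    _ ≤ 16 * (N : ℝ) ^ ((4 : ℝ) / 3) * (4 * Real.log N) ^ 9 := by
        gcongr
        exact one_add_log_two_mul_le hN
    _ = _ := by ring
end
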